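/- arXiv:2511.05164 — 4 statements merged into one kernel-verified Lean document; each statement's English description precedes it below -/
import Mathlib

section
/- Let q be a prime power and let χ be an irreducible complex character of PGL_2(q) of degree q such that χ(g) = 1 for every element g of order q−1 (the Steinberg character). Then for any representation Φ affording χ and any element h of PGL_2(q) of order q+1, the linear map Φ(h) does not have 1 as an eigenvalue; in particular χ is not unisingular. -/
open Module FDRep Matrix CategoryTheory

/-- A finite-dimensional complex representation of a group is *unisingular* if every group
element acts with `1` as an eigenvalue. -/
def FDRep.IsUnisingular {G : Type} [Monoid G] (V : FDRep ℂ G) : Prop :=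
  ∀ g : G, Module.End.HasEigenvalue (V.ρ g) 1


/-- The projective general linear group: the quotient of `GL n R` by its center. -/
abbrev Matrix.ProjectiveGeneralLinearGroup (n : Type*) [DecidableEq n] [Fintype n]
    (R : Type*) [CommRing R] : Type _ :=
  GL n R ⧸ Subgroup.center (GL n R)

/-- `PGL₂(F)`, the projective general linear group of degree 2 over `F`. -/
abbrev PGL2 (F : Type) [Field F] : Type _ :=
  Matrix.ProjectiveGeneralLinearGroup (Fin 2) F

theorem FDRep.eq_bot_or_eq_top_of_simple {k G : Type} [Field k] [Group G] (V : FDRep k G)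
    [Simple V] (W : Submodule k V) (hW : ∀ g, ∀ v ∈ W, V.ρ g v ∈ W) : W = ⊥ ∨ W = ⊤ := by
  let σ : Representation k G W :=
    { toFun g := (V.ρ g).restrict (hW g)
      map_one' := by ext; simp
      map_mul' g h := by ext; simp }
  let f : FDRep.of σ ⟶ V :=
    ⟨InducedCategory.homMk (ModuleCat.ofHom W.subtype), fun g ↦ by ext; rfl⟩
  have : Mono f := ConcreteCategory.mono_of_injective f Subtype.val_injective
  by_cases hf : f = 0
  · left
    rw [Submodule.eq_bot_iff]
    intro v hv
    have := congrArg (fun φ : FDRep.of σ ⟶ V ↦ φ.hom.hom.hom ⟨v, hv⟩) hf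
    exact this
  · right
    have := isIso_of_mono_of_nonzero hf
    rw [Submodule.eq_top_iff']
    intro v
    obtain ⟨w, hw⟩ := (FDRep.isoToLinearEquiv (asIso f)).surjective v
    rw [← hw]
    exact w.2

/-- A simple representation of dimension other than one has no stable line. -/
theorem FDRep.eq_zero_of_stable_line {k G : Type} [Field k] [Group G] (V : FDRep k G)
    [Simple V] (hdim : finrank k V ≠ 1) (v : V) (hv : ∀ g, ∃ c : k, V.ρ g v = c • v) :
    v = 0 := by
  by_contra hne
  rcases V.eq_bot_or_eq_top_of_simple (k ∙ v) (fun g w hw ↦ by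
    obtain ⟨a, rfl⟩ := Submodule.mem_span_singleton.1 hw
    obtain ⟨c, hc⟩ := hv g
    rw [map_smul, hc, smul_smul]
    exact Submodule.smul_mem _ _ (Submodule.mem_span_singleton_self v)) with h | h
  · exact hne (Submodule.span_singleton_eq_bot.1 h)
  · exact hdim ((finrank_eq_one_iff_of_nonzero v hne).2 h)

/-- If a finite group factors as `⟨h⟩ B` and a simple representation of dimension other than one
contains a nonzero vector fixed by `B`, then `h` has no nonzero fixed vector. -/
theorem FDRep.not_hasEigenvalue_one_of_isComplement' {k G : Type} [Field k] [CharZero k] [Group G]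
    [Finite G] (V : FDRep k G) [Simple V] (hdim : finrank k V ≠ 1) {h : G} {B : Subgroup G}
    (hB : (Subgroup.zpowers h).IsComplement' B) {v : V} (hv : v ≠ 0)
    (hfix : ∀ b ∈ B, V.ρ b v = v) : ¬ Module.End.HasEigenvalue (V.ρ h) 1 := by
  classical
  have := Fintype.ofFinite G
  let N : Module.End k V := ∑ x : Subgroup.zpowers h, V.ρ x
  have N_apply (w : V) : N w = ∑ x : Subgroup.zpowers h, V.ρ x w := by
    simp [N, LinearMap.sum_apply]
  have hsum : ∑ g : G, V.ρ g v = (Nat.card B : k) • N v := by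
    rw [← (Equiv.ofBijective _ hB).sum_comp, Fintype.sum_prod_type, N_apply, Finset.smul_sum]
    refine Finset.sum_congr rfl fun x _ ↦ ?_
    simp [Equiv.ofBijective_apply, hfix, Nat.cast_smul_eq_nsmul]
  have hNv : N v = 0 := by
    have h0 : ∑ g : G, V.ρ g v = 0 := V.eq_zero_of_stable_line hdim _ fun g ↦ ⟨1, by
      rw [one_smul, map_sum, ← Equiv.sum_comp (Equiv.mulLeft g) fun x ↦ V.ρ x v]
      simp⟩
    rw [hsum] at h0
    exact (smul_eq_zero.1 h0).resolve_left (Nat.cast_ne_zero.2 Nat.card_pos.ne')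
  have hspan : Submodule.span k (Set.range fun g ↦ V.ρ g v) = ⊤ := by
    refine (V.eq_bot_or_eq_top_of_simple _ fun g w hw ↦ ?_).resolve_left fun hbot ↦ hv ?_
    · induction hw using Submodule.span_induction with
      | mem x hx =>
        obtain ⟨g', rfl⟩ := hx
        exact Submodule.subset_span ⟨g * g', by simp⟩
      | zero => simp
      | add x y _ _ hx hy => rw [map_add]; exact add_mem hx hy
      | smul a x _ hx => rw [map_smul]; exact Submodule.smul_mem _ _ hx
    · exact Submodule.span_eq_bot.1 hbot v ⟨1, by simp⟩
  have hN : N = 0 := by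
    refine LinearMap.ext_on_range hspan fun g ↦ ?_
    obtain ⟨⟨y, b⟩, rfl⟩ := hB.2 g
    rw [LinearMap.zero_apply, ← hNv, N_apply, N_apply]
    refine Eq.trans ?_
      (Equiv.sum_comp (Equiv.mulRight (y : Subgroup.zpowers h)) fun x ↦ V.ρ x v)
    simp [hfix]
  intro hev
  obtain ⟨w, hw⟩ := hev.exists_hasEigenvector
  have hw1 : V.ρ h w = w := by simpa using hw.apply_eq_smul
  have hpow (x : Subgroup.zpowers h) : V.ρ x w = w := by
    obtain ⟨n, hn⟩ := mem_powers_iff_mem_zpowers.2 x.2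
    have : Function.IsFixedPt (V.ρ h)^[n] w := Function.IsFixedPt.iterate hw1 n
    rw [← hn, map_pow, Module.End.pow_apply]
    exact this
  have h0 : N w = 0 := by rw [hN, LinearMap.zero_apply]
  rw [N_apply, Finset.sum_congr rfl fun x _ ↦ hpow x, Finset.sum_const,
    ← Nat.cast_smul_eq_nsmul k] at h0
  exact hw.2 ((smul_eq_zero.1 h0).resolve_left (Nat.cast_ne_zero.2 (by simp)))

namespace PGL2

variable {F : Type} [Field F]

theorem mk_eq_one_iff (A : GL (Fin 2) F) :
    (A : PGL2 F) = 1 ↔ A 1 0 = 0 ∧ A 0 1 = 0 ∧ A 0 0 = A 1 1 := by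
  rw [QuotientGroup.eq_one_iff, GeneralLinearGroup.mem_center_iff_val_mem_range_scalar]
  constructor
  · rintro ⟨c, hc⟩
    simp [← hc]
  · rintro ⟨h10, h01, h00⟩
    refine ⟨A 1 1, ?_⟩
    ext i j
    fin_cases i <;> fin_cases j <;> simp [h10, h01, h00]

/-- The matrix of the affine map `x ↦ a x + b`. -/
def affine (a : Fˣ) (b : F) : GL (Fin 2) F :=
  GeneralLinearGroup.mkOfDetNeZero !![(a : F), b; 0, 1] (by simp)

theorem val_affine (a : Fˣ) (b : F) : (affine a b).val = !![(a : F), b; 0, 1] := rfl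

theorem affine_mul (a a' : Fˣ) (b b' : F) :
    affine a b * affine a' b' = affine (a * a') (a * b' + b) := by
  ext i j
  fin_cases i <;> fin_cases j <;> simp [val_affine]

theorem affine_one : affine (1 : Fˣ) 0 = 1 := by
  ext i j
  fin_cases i <;> fin_cases j <;> simp [val_affine]

theorem affine_inv (a : Fˣ) (b : F) : (affine a b)⁻¹ = affine a⁻¹ (-(a⁻¹ * b)) := by
  rw [inv_eq_iff_mul_eq_one, affine_mul, ← affine_one]
  congr 1 <;> simp

theorem mk_affine_injective :
    Function.Injective fun x : Fˣ × F ↦ (affine x.1 x.2 : PGL2 F) := by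
  rintro ⟨a, b⟩ ⟨a', b'⟩ h
  have h := (mk_eq_one_iff _).1 ((QuotientGroup.mk_mul _ _ _).trans (inv_mul_eq_one.2 h))
  rw [affine_inv, affine_mul] at h
  simp only [val_affine, of_apply, cons_val', cons_val_zero, cons_val_one, cons_val_fin_one] at h
  obtain ⟨-, hb, ha⟩ := h
  have haa : a = a' := by
    rw [← inv_mul_eq_one, ← Units.val_inj]
    exact ha
  subst haa
  have : b' = b := by simpa [add_neg_eq_zero] using hb
  rw [this]

variable (F) in
/-- The stabilizer of the point at infinity, i.e. the image of the affine group. -/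
def borel : Subgroup (PGL2 F) where
  carrier := Set.range fun x : Fˣ × F ↦ (affine x.1 x.2 : PGL2 F)
  one_mem' := ⟨(1, 0), by simp [affine_one]⟩
  mul_mem' := by
    rintro _ _ ⟨x, rfl⟩ ⟨y, rfl⟩
    exact ⟨(x.1 * y.1, x.1 * y.2 + x.2), by simp [← affine_mul]⟩
  inv_mem' := by
    rintro _ ⟨x, rfl⟩
    exact ⟨(x.1⁻¹, -(x.1⁻¹ * x.2)), by rw [← QuotientGroup.mk_inv, affine_inv]⟩

theorem affine_mem_borel (a : Fˣ) (b : F) : (affine a b : PGL2 F) ∈ borel F := ⟨(a, b), rfl⟩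

theorem mk_mem_borel {A : GL (Fin 2) F} (hA : A 1 0 = 0) : (A : PGL2 F) ∈ borel F := by
  have hdet : A 0 0 * A 1 1 ≠ 0 := by
    have := A.det_ne_zero
    rwa [det_fin_two, hA, mul_zero, sub_zero] at this
  have h0 := left_ne_zero_of_mul hdet
  have h1 := right_ne_zero_of_mul hdet
  have : (A : PGL2 F) = affine (Units.mk0 (A 0 0 / A 1 1) (div_ne_zero h0 h1)) (A 0 1 / A 1 1) := by
    rw [eq_comm, ← inv_mul_eq_one, ← QuotientGroup.mk_inv, ← QuotientGroup.mk_mul, mk_eq_one_iff,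
      affine_inv]
    simp [val_affine, mul_apply, Fin.sum_univ_two, hA]
    field_simp
    simp
  rw [this]
  exact affine_mem_borel _ _

theorem card_borel [Fintype F] :
    Nat.card (borel F) = (Fintype.card F - 1) * Fintype.card F := by
  rw [← Nat.card_eq_fintype_card, ← Nat.card_units, ← Nat.card_prod]
  exact (Nat.card_congr (Equiv.ofInjective _ mk_affine_injective)).symm

theorem card_eq [Fintype F] :
    Nat.card (PGL2 F) = (Fintype.card F + 1) * ((Fintype.card F - 1) * Fintype.card F) := by
  have hq := Fintype.one_lt_card (α := F)
  have hZ : Nat.card (Subgroup.center (GL (Fin 2) F)) = Fintype.card F - 1 := by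
    rw [GeneralLinearGroup.center_eq_range_scalar, ← Nat.card_eq_fintype_card, ← Nat.card_units]
    refine (Nat.card_congr (Equiv.ofInjective _ fun a b hab ↦ ?_)).symm
    have := congrArg (fun A : GL (Fin 2) F ↦ A 0 0) hab
    simpa [Units.ext_iff] using this
  have h := Subgroup.card_eq_card_quotient_mul_card_subgroup (Subgroup.center (GL (Fin 2) F))
  rw [hZ, card_GL_field, Fin.prod_univ_two] at h
  obtain ⟨n, hn⟩ : ∃ n, Fintype.card F = n + 2 := ⟨Fintype.card F - 2, by omega⟩
  rw [hn] at h ⊢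
  refine Nat.eq_of_mul_eq_mul_right (show 0 < n + 2 - 1 by omega) (h.symm.trans ?_)
  have e1 : (n + 2) ^ 2 - (n + 2) ^ 0 = (n + 1) * (n + 3) := by
    rw [Nat.sub_eq_iff_eq_add (by simp [Nat.one_le_pow])]; ring
  have e2 : (n + 2) ^ 2 - (n + 2) ^ 1 = (n + 1) * (n + 2) := by
    rw [Nat.sub_eq_iff_eq_add (Nat.pow_le_pow_right (by omega) (by omega))]; ring
  have e3 : n + 2 - 1 = n + 1 := rfl
  simp only [Fin.val_zero, Fin.val_one, e1, e2, e3]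
  ring

instance [Finite F] : Finite (PGL2 F) := Quotient.finite _

theorem eq_one_of_commute {A M : GL (Fin 2) F} (hAM : Commute A M) (hA : A 1 0 ≠ 0)
    (hM : M 1 0 = 0) : (M : PGL2 F) = 1 := by
  rw [mk_eq_one_iff]
  have h := congrArg Units.val hAM.eq
  have h10 := congrFun (congrFun h 1) 0
  have h00 := congrFun (congrFun h 0) 0
  simp only [Units.val_mul, mul_apply, Fin.sum_univ_two, hM] at h10 h00
  have e : M 0 0 = M 1 1 := mul_left_cancel₀ hA (by linear_combination h10)
  refine ⟨hM, (mul_eq_zero.1 ?_).resolve_right hA, e⟩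
  linear_combination -h00

theorem isComplement'_zpowers_borel [Fintype F] {h : PGL2 F}
    (hh : orderOf h = Fintype.card F + 1) : (Subgroup.zpowers h).IsComplement' (borel F) := by
  have hq := Fintype.one_lt_card (α := F)
  refine Subgroup.isComplement'_of_card_mul_and_disjoint
    (by rw [Nat.card_zpowers, hh, card_borel, card_eq]) ?_
  have hnot : h ∉ borel F := fun hmem ↦ by
    have hdvd := Subgroup.orderOf_dvd_natCard _ hmem
    rw [hh, card_borel] at hdvd
    have := Nat.le_of_dvd (by omega)
      (Nat.Coprime.dvd_of_dvd_mul_right (Nat.coprime_self_add_left.2 (by simp)) hdvd)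
    omega
  obtain ⟨A, rfl⟩ := QuotientGroup.mk_surjective h
  have hA : A 1 0 ≠ 0 := fun h0 ↦ hnot (mk_mem_borel h0)
  rw [Subgroup.disjoint_def]
  rintro x hx ⟨⟨a, b⟩, rfl⟩
  obtain ⟨n, hn⟩ := hx
  obtain ⟨c, hc⟩ : ∃ c : GL (Fin 2) F, c ∈ Subgroup.center _ ∧ A ^ n * c = affine a b := by
    have : ((A ^ n : GL (Fin 2) F) : PGL2 F) = affine a b := hn
    rw [QuotientGroup.eq] at this
    exact ⟨_, this, by group⟩
  refine eq_one_of_commute (A := A) ?_ hA (by simp [val_affine])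
  rw [← hc.2]
  exact ((Commute.refl A).zpow_right n).mul_right (Subgroup.mem_center_iff.1 hc.1 A)

/-- Singer cycles: `PGL₂(q)` contains an element of order `q + 1`. -/
theorem exists_orderOf_eq_card_add_one [Fintype F] :
    ∃ h : PGL2 F, orderOf h = Fintype.card F + 1 := by
  have hq := Fintype.one_lt_card (α := F)
  obtain ⟨p, hchar⟩ := CharP.exists F
  have : Fact p.Prime := ⟨CharP.char_is_prime F p⟩
  let K := FiniteField.Extension F p 2
  let bas : Basis (Fin 2) F K :=
    finBasisOfFinrankEq F K (FiniteField.finrank_extension F p 2)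
  obtain ⟨ζ, hζ⟩ := IsCyclic.exists_generator (α := Kˣ)
  have hζo : orderOf ζ = (Fintype.card F + 1) * (Fintype.card F - 1) := by
    rw [orderOf_eq_card_of_forall_mem_zpowers hζ, Nat.card_units,
      FiniteField.natCard_extension, Nat.card_eq_fintype_card, ← Nat.sq_sub_sq, one_pow]
  let φ : Kˣ →* GL (Fin 2) F := Units.map (Algebra.leftMulMatrix bas).toMonoidHom
  let h : PGL2 F := (φ ζ : GL (Fin 2) F)
  have hdvd : Fintype.card F + 1 ∣ orderOf h := by
    have h1 : ((φ (ζ ^ orderOf h) : GL (Fin 2) F) : PGL2 F) = 1 := by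
      rw [map_pow]
      exact pow_orderOf_eq_one h
    rw [QuotientGroup.eq_one_iff, GeneralLinearGroup.mem_center_iff_val_mem_range_scalar] at h1
    obtain ⟨c, hc⟩ := h1
    have hc' : algebraMap F K c = (ζ ^ orderOf h : Kˣ) := by
      apply Algebra.leftMulMatrix_injective bas
      rw [AlgHom.commutes]
      exact hc
    have hc0 : c ≠ 0 := by
      rintro rfl
      rw [map_zero] at hc'
      exact (ζ ^ orderOf h).ne_zero hc'.symm
    have h2 : ζ ^ (orderOf h * (Fintype.card F - 1)) = 1 := by
      rw [pow_mul, Units.ext_iff, Units.val_pow_eq_pow_val, ← hc', ← map_pow,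
        FiniteField.pow_card_sub_one_eq_one c hc0, map_one, Units.val_one]
    have h3 := orderOf_dvd_of_pow_eq_one h2
    rw [hζo] at h3
    exact Nat.dvd_of_mul_dvd_mul_right (by omega) h3
  exact ⟨_, orderOf_pow_orderOf_div (orderOf_pos h).ne' hdvd⟩

open Multiplicative

/-- The image of the diagonal torus. -/
def torus : Fˣ →* PGL2 F where
  toFun a := affine a 0
  map_one' := by rw [affine_one]; rfl
  map_mul' a b := by rw [← QuotientGroup.mk_mul, affine_mul]; simp

/-- The image of the group of upper unitriangular matrices. -/
def unipotent : Multiplicative F →* PGL2 F where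
  toFun b := affine 1 b.toAdd
  map_one' := by simp [affine_one]
  map_mul' a b := by rw [← QuotientGroup.mk_mul, affine_mul]; simp [add_comm]

theorem torus_injective : Function.Injective (torus (F := F)) := fun a b h ↦
  congrArg Prod.fst (@mk_affine_injective F _ (a, 0) (b, 0) h)

theorem mk_affine_eq (a : Fˣ) (b : F) :
    (affine a b : PGL2 F) = unipotent (ofAdd b) * torus a := by
  change _ = (affine 1 b : PGL2 F) * (affine a 0 : GL (Fin 2) F)
  rw [← QuotientGroup.mk_mul, affine_mul]
  simp

theorem torus_mul_unipotent (a : Fˣ) (b : F) :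
    torus a * unipotent (ofAdd b) = unipotent (ofAdd (a * b)) * torus a := by
  rw [← mk_affine_eq]
  change (affine a 0 : PGL2 F) * (affine 1 b : GL (Fin 2) F) = _
  rw [← QuotientGroup.mk_mul, affine_mul]
  simp

variable (V : FDRep ℂ (PGL2 F))

theorem character_unipotent {b : F} (hb : b ≠ 0) :
    V.character (unipotent (ofAdd b)) = V.character (unipotent (ofAdd 1)) := by
  have h := torus_mul_unipotent (Units.mk0 b hb) 1
  rw [Units.val_mk0, mul_one, ← mul_inv_eq_iff_eq_mul] at h
  rw [← h, FDRep.char_conj]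

theorem character_torus_mul_unipotent {a : Fˣ} (ha : a ≠ 1) (b : F) :
    V.character (torus a * unipotent (ofAdd b)) = V.character (torus a) := by
  have ha' : 1 - (a : F) ≠ 0 := sub_ne_zero.2 fun h ↦ ha (Units.ext h.symm)
  have h : torus a * unipotent (ofAdd b) = unipotent (ofAdd (a * b / (1 - a))) * torus a *
      (unipotent (ofAdd (a * b / (1 - a))))⁻¹ := by
    rw [eq_mul_inv_iff_mul_eq, mul_assoc, ← map_mul, ← ofAdd_add, torus_mul_unipotent]
    congr 3
    field_simp
    ring
  rw [h, FDRep.char_conj]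

/-- If the unipotent elements act trivially, then every eigenvector of a generator of the torus
spans a stable line. -/
theorem exists_smul_of_unipotent_trivial (hU : ∀ b, V.ρ (unipotent b) = 1) {a : Fˣ}
    (ha : ∀ x, x ∈ Submonoid.powers a) {v : V} {c : ℂ} (hv : V.ρ (torus a) v = c • v)
    (g : PGL2 F) : ∃ c : ℂ, V.ρ g v = c • v := by
  have hB (x) (hx : x ∈ borel F) : ∃ c : ℂ, V.ρ x v = c • v := by
    obtain ⟨⟨y, b⟩, rfl⟩ := hx
    obtain ⟨n, rfl⟩ := ha y
    refine ⟨c ^ n, ?_⟩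
    simp only [mk_affine_eq, map_mul, hU, one_mul, map_pow]
    induction n with
    | zero => simp
    | succ n ih => rw [pow_succ, Module.End.mul_apply, hv, map_smul, ih, smul_smul, pow_succ']
  obtain ⟨A, rfl⟩ := QuotientGroup.mk_surjective g
  refine diagonal_transvection_induction_of_det_ne_zero
    (fun M ↦ ∀ A : GL (Fin 2) F, A.val = M → ∃ c : ℂ, V.ρ A v = c • v) A.val A.det_ne_zero
    ?_ ?_ ?_ A rfl
  · exact fun D _ A hA ↦ hB _ (mk_mem_borel (by simp [hA]))
  · rintro ⟨i, j, hij, b⟩ A hA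
    by_cases hi : i = 0
    · exact hB _ (mk_mem_borel (by simp [hA, transvection, hi]))
    · obtain rfl : i = 1 := by omega
      obtain rfl : j = 0 := by omega
      let w : GL (Fin 2) F := GeneralLinearGroup.mkOfDetNeZero !![0, 1; 1, 0] (by simp)
      have hw : A = w * affine 1 b * w⁻¹ := by
        rw [eq_mul_inv_iff_mul_eq]
        have hw' : w.val = !![0, 1; 1, 0] := rfl
        ext i j
        fin_cases i <;> fin_cases j <;>
          simp [hA, hw', val_affine, transvection, TransvectionStruct.toMatrix, mul_apply,
            Fin.sum_univ_two]
      refine ⟨1, ?_⟩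
      have hb : V.ρ (affine 1 b : GL (Fin 2) F) = 1 := hU (ofAdd b)
      rw [hw, QuotientGroup.mk_mul, QuotientGroup.mk_mul, map_mul, map_mul, hb, mul_one, ← map_mul,
        ← QuotientGroup.mk_mul, mul_inv_cancel]
      simp
  · intro X Y hX hY ihX ihY A hA
    have hA' : A = GeneralLinearGroup.mkOfDetNeZero X hX * GeneralLinearGroup.mkOfDetNeZero Y hY :=
      Units.ext hA
    obtain ⟨x, hx⟩ := ihX (GeneralLinearGroup.mkOfDetNeZero X hX) rfl
    obtain ⟨y, hy⟩ := ihY (GeneralLinearGroup.mkOfDetNeZero Y hY) rfl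
    refine ⟨y * x, ?_⟩
    rw [hA', QuotientGroup.mk_mul, map_mul, Module.End.mul_apply, hy, map_smul, hx, smul_smul]

variable [Fintype F]

/-- The projection onto the subspace on which the unipotent elements act through `ψ`. -/
noncomputable def weightProj (ψ : AddChar F ℂ) : Module.End ℂ V :=
  (Fintype.card F : ℂ)⁻¹ • ∑ b : F, ψ (-b) • V.ρ (unipotent (ofAdd b))

theorem unipotent_mul_weightProj (ψ : AddChar F ℂ) (x : F) :
    V.ρ (unipotent (ofAdd x)) * weightProj V ψ = ψ x • weightProj V ψ := by
  rw [weightProj, mul_smul_comm, Finset.mul_sum, smul_comm (ψ x), Finset.smul_sum (r := ψ x),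
    ← Equiv.sum_comp (Equiv.addLeft x) fun b ↦ ψ x • ψ (-b) • V.ρ (unipotent (ofAdd b))]
  congr 1
  refine Finset.sum_congr rfl fun b _ ↦ ?_
  rw [mul_smul_comm, ← map_mul, ← map_mul, ← ofAdd_add, smul_smul, ← AddChar.map_add_eq_mul]
  simp

theorem isIdempotentElem_weightProj (ψ : AddChar F ℂ) : IsIdempotentElem (weightProj V ψ) := by
  have h : weightProj V ψ * weightProj V ψ = (Fintype.card F : ℂ)⁻¹ •
      ∑ b : F, ψ (-b) • (V.ρ (unipotent (ofAdd b)) * weightProj V ψ) := by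
    nth_rw 1 [weightProj]
    simp [Finset.sum_mul]
  rw [IsIdempotentElem, h]
  simp [unipotent_mul_weightProj, smul_smul, ← AddChar.map_add_eq_mul,
    ← Nat.cast_smul_eq_nsmul ℂ]

theorem card_mul_finrank_range_weightProj (ψ : AddChar F ℂ) :
    (Fintype.card F : ℂ) * finrank ℂ (LinearMap.range (weightProj V ψ)) =
      V.character (unipotent (ofAdd 1)) * ∑ b, ψ b +
        (finrank ℂ V - V.character (unipotent (ofAdd 1))) := by
  classical
  rw [← (LinearMap.IsIdempotentElem.isProj_range _ (isIdempotentElem_weightProj V ψ)).trace,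
    weightProj, map_smul, smul_eq_mul, mul_inv_cancel_left₀ (by simp), map_sum,
    ← Equiv.sum_comp (Equiv.neg F) ψ, Finset.mul_sum]
  have h (b : F) : LinearMap.trace ℂ V (ψ (-b) • V.ρ (unipotent (ofAdd b))) =
      V.character (unipotent (ofAdd 1)) * ψ (-b) +
        if b = 0 then finrank ℂ V - V.character (unipotent (ofAdd 1)) else 0 := by
    rw [map_smul, smul_eq_mul]
    change _ * V.character _ = _
    split_ifs with hb
    · simp [hb]
    · rw [character_unipotent V hb]
      ring
  simp [h, Finset.sum_add_distrib]

theorem finrank_range_weightProj_one (hq : 2 < Fintype.card F)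
    (hdeg : finrank ℂ V = Fintype.card F) :
    finrank ℂ (LinearMap.range (weightProj V 1)) = 1 ∨
      finrank ℂ (LinearMap.range (weightProj V 1)) = Fintype.card F := by
  obtain ⟨ψ, hψ⟩ := AddChar.exists_apply_ne_zero.2 (one_ne_zero (α := F))
  have hd := card_mul_finrank_range_weightProj V 1
  have hm := card_mul_finrank_range_weightProj V ψ
  rw [AddChar.sum_eq_zero_of_ne_one (AddChar.ne_one_iff.2 ⟨1, hψ⟩)] at hm
  rw [AddChar.sum_eq_card_of_eq_one rfl] at hd
  rw [hdeg] at hd hm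
  generalize finrank ℂ (LinearMap.range (weightProj V 1)) = d at *
  generalize finrank ℂ (LinearMap.range (weightProj V ψ)) = m at *
  generalize V.character _ = c at *
  generalize Fintype.card F = q at *
  have key : d + q * m = q + m := by
    have h0 : (q : ℂ) ≠ 0 := Nat.cast_ne_zero.2 (by omega)
    have : (q : ℂ) * (d + q * m) = q * (q + m) := by linear_combination hd + (q - 1) * hm
    exact_mod_cast mul_left_cancel₀ h0 this
  rcases m with _ | _ | m
  · omega
  · omega
  · nlinarith

/-- The Borel subgroup has a nonzero fixed vector in the Steinberg representation. -/
theorem exists_borel_fixed [Simple V] (hdeg : finrank ℂ V = Fintype.card F)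
    (hval : ∀ g : PGL2 F, orderOf g = Fintype.card F - 1 → V.character g = 1) :
    ∃ v : V, v ≠ 0 ∧ ∀ b ∈ borel F, V.ρ b v = v := by
  have hq1 := Fintype.one_lt_card (α := F)
  have hq : 2 < Fintype.card F := by
    by_contra! hle
    have h1 := hval 1 (by rw [orderOf_one]; omega)
    rw [FDRep.char_one, hdeg, Nat.cast_eq_one] at h1
    omega
  obtain ⟨a, ha⟩ := IsCyclic.exists_generator (α := Fˣ)
  have hao : orderOf a = Fintype.card F - 1 := by
    rw [orderOf_eq_card_of_forall_mem_zpowers ha, Nat.card_units, Nat.card_eq_fintype_card]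
  have ha1 : a ≠ 1 := by
    rintro rfl
    rw [orderOf_one] at hao
    omega
  have ha' (x) : x ∈ Submonoid.powers a := mem_powers_iff_mem_zpowers.2 (ha x)
  have hta : V.character (torus a) = 1 :=
    hval _ (by rw [orderOf_injective torus torus_injective, hao])
  set E := weightProj V 1 with hE
  have hUE (b : F) : V.ρ (unipotent (ofAdd b)) * E = E := by
    rw [hE, unipotent_mul_weightProj]; simp
  have hidem : IsIdempotentElem E := isIdempotentElem_weightProj V 1
  rcases finrank_range_weightProj_one V hq hdeg with h1 | hd
  · obtain ⟨⟨v, y, rfl⟩, hv, hspan⟩ := finrank_eq_one_iff'.1 h1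
    have hv0 : E y ≠ 0 := fun h ↦ hv (Subtype.ext h)
    have hspan' (x : V) : ∃ c : ℂ, E x = c • E y := by
      obtain ⟨c, hc⟩ := hspan ⟨E x, x, rfl⟩
      exact ⟨c, (congrArg Subtype.val hc).symm⟩
    have hcomm : V.ρ (torus a) * E = E * V.ρ (torus a) := by
      rw [hE, weightProj, mul_smul_comm, smul_mul_assoc, Finset.mul_sum, Finset.sum_mul,
        ← Equiv.sum_comp (Units.mulLeft a) fun b ↦ _ * V.ρ (torus a)]
      simp [← map_mul, torus_mul_unipotent]
    obtain ⟨c, hc⟩ := hspan' (V.ρ (torus a) y)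
    have hc' : V.ρ (torus a) (E y) = c • E y := by
      rw [← hc, ← Module.End.mul_apply, hcomm, Module.End.mul_apply]
    have hscal : V.ρ (torus a) * E = c • E := by
      ext x
      obtain ⟨d, hd⟩ := hspan' x
      rw [Module.End.mul_apply, LinearMap.smul_apply, hd, map_smul, hc', smul_comm]
    have hc1 : c = 1 := by
      have htr := congrArg (LinearMap.trace ℂ V) hscal
      rw [map_smul, (LinearMap.IsIdempotentElem.isProj_range _ hidem).trace, h1, hE, weightProj,
        mul_smul_comm, Finset.mul_sum, map_smul, map_sum, Finset.sum_congr rfl (fun b _ ↦ (by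
          rw [AddChar.one_apply, one_smul, ← map_mul]
          exact character_torus_mul_unipotent V ha1 b :
            LinearMap.trace ℂ V (V.ρ (torus a) * ((1 : AddChar F ℂ) (-b) •
              V.ρ (unipotent (ofAdd b)))) = V.character (torus a))), hta] at htr
      simpa using htr.symm
    rw [hc1, one_smul] at hc'
    refine ⟨E y, hv0, ?_⟩
    rintro _ ⟨⟨x, b⟩, rfl⟩
    obtain ⟨n, rfl⟩ := ha' x
    have hn : V.ρ (torus (a ^ n)) (E y) = E y := by
      rw [map_pow, map_pow, Module.End.pow_apply]
      exact Function.IsFixedPt.iterate hc' n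
    simp only [mk_affine_eq, map_mul, Module.End.mul_apply, hn]
    exact LinearMap.congr_fun (hUE b) y
  · exfalso
    have hsurj : Function.Surjective E :=
      LinearMap.range_eq_top.1 (Submodule.eq_top_of_finrank_eq (hd.trans hdeg.symm))
    have hU (b : Multiplicative F) : V.ρ (unipotent b) = 1 := by
      ext x
      obtain ⟨y, rfl⟩ := hsurj x
      exact LinearMap.congr_fun (hUE b.toAdd) y
    have : Nontrivial V := Module.nontrivial_of_finrank_pos (R := ℂ) (by omega)
    obtain ⟨c, hc⟩ := Module.End.exists_eigenvalue (V.ρ (torus a))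
    obtain ⟨v, hv⟩ := hc.exists_hasEigenvector
    exact hv.2 (V.eq_zero_of_stable_line (by omega) v
      (exists_smul_of_unipotent_trivial V hU ha' hv.apply_eq_smul))

end PGL2

/-- For a finite field `F` with `q` elements, if `χ` is an irreducible
character of `PGL₂(q)` of degree `q` taking the value `1` on every element of order
`q - 1` (the Steinberg character), then for any representation affording `χ` and any
element `h` of order `q + 1`, `Φ(h)` does not have `1` as an eigenvalue; in particular
`χ` is not unisingular. -/
theorem steinberg_PGL2_not_unisingular (q : ℕ) (F : Type) [Field F] [Fintype F]
    (hF : Fintype.card F = q) (V : FDRep ℂ (PGL2 F)) (hV : Simple V)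
    (hdeg : Module.finrank ℂ V = q)
    (hval : ∀ g : PGL2 F, orderOf g = q - 1 → V.character g = 1) :
    (∀ h : PGL2 F, orderOf h = q + 1 → ¬ Module.End.HasEigenvalue (V.ρ h) 1) ∧
      ¬ V.IsUnisingular := by
  subst hF
  have hq := Fintype.one_lt_card (α := F)
  obtain ⟨v, hv, hfix⟩ := PGL2.exists_borel_fixed V hdeg hval
  have hfree (h : PGL2 F) (hh : orderOf h = Fintype.card F + 1) :
      ¬ Module.End.HasEigenvalue (V.ρ h) 1 :=
    V.not_hasEigenvalue_one_of_isComplement' (by omega) (PGL2.isComplement'_zpowers_borel hh)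
      hv hfix
  obtain ⟨h, hh⟩ := PGL2.exists_orderOf_eq_card_add_one (F := F)
  exact ⟨hfree, fun hV ↦ hfree h hh (hV h)⟩
end

section
/- Every finite nonabelian group G with nontrivial center Z(G) ≠ 1 admits an irreducible complex character of degree greater than 1 which is not unisingular. -/
open Module FDRep Matrix CategoryTheory

open scoped MonoidAlgebra commutatorElement

/-- An irreducible finite-dimensional representation of a finite group over an algebraically closed
field of good characteristic is a simple object of `FDRep`. -/
theorem FDRep.simple_of_isIrreducible {k V : Type} {G : Type} [Field k] [IsAlgClosed k] [Group G]
    [Finite G] [NeZero (Nat.card G : k)] [AddCommGroup V] [Module k V] [Module.Finite k V]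
    (ρ : Representation k G V) [ρ.IsIrreducible] : Simple (FDRep.of ρ) := by
  rw [FDRep.simple_iff_end_is_rank_one, ← Representation.IsIrreducible.finrank_intertwiningMap_self ρ]
  exact ((FDRep.forget₂HomLinearEquiv _ _).symm ≪≫ₗ Rep.homLinearEquiv _ _).finrank_eq

/-- A central element having an eigenvalue on an irreducible representation acts by that scalar. -/
theorem Representation.IsIrreducible.apply_eq_smul_of_hasEigenvalue {k G V : Type*} [Field k]
    [Monoid G] [AddCommGroup V] [Module k V] {ρ : Representation k G V} [ρ.IsIrreducible]
    {z : G} (hz : ∀ g, g * z = z * g) {μ : k} (h : Module.End.HasEigenvalue (ρ z) μ) (v : V) :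
    ρ z v = μ • v := by
  let W : Subrepresentation ρ :=
    { toSubmodule := Module.End.eigenspace (ρ z) μ
      apply_mem_toSubmodule := fun g v hv ↦ by
        rw [Module.End.mem_eigenspace_iff] at hv ⊢
        rw [← Module.End.mul_apply, ← map_mul, ← hz, map_mul, Module.End.mul_apply, hv, map_smul] }
  have hW : W = ⊤ := (eq_bot_or_eq_top W).resolve_left fun hb ↦
    h (congrArg Subrepresentation.toSubmodule hb)
  have hv : v ∈ (⊤ : Submodule k V) := Submodule.mem_top
  have ht : Module.End.eigenspace (ρ z) μ = ⊤ := congrArg Subrepresentation.toSubmodule hW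
  rwa [← ht, Module.End.mem_eigenspace_iff] at hv

/-- Endomorphisms of a vector space of dimension at most one commute. -/
theorem Module.End.commute_of_finrank_le_one {k V : Type*} [Field k] [AddCommGroup V] [Module k V]
    [Module.Finite k V] (h : finrank k V ≤ 1) (f g : Module.End k V) : Commute f g := by
  obtain ⟨v, hv⟩ := finrank_le_one_iff.mp h
  obtain ⟨a, ha⟩ := hv (f v)
  obtain ⟨b, hb⟩ := hv (g v)
  ext w
  obtain ⟨c, rfl⟩ := hv w
  simp [Module.End.mul_apply, ← ha, ← hb, smul_comm a b]

/-- A nonzero element of a semisimple ring acts nontrivially on some simple left ideal. -/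
theorem IsSemisimpleRing.exists_simple_smul_ne_zero {R : Type*} [Ring R] [IsSemisimpleRing R]
    {x : R} (hx : x ≠ 0) : ∃ S : Submodule R R, IsSimpleModule R S ∧ ∃ s : S, x • s ≠ 0 := by
  by_contra! h
  have hann : x ∈ (⊤ : Submodule R R).annihilator := by
    rw [← IsSemisimpleModule.sSup_simples_eq_top R R, sSup_eq_iSup', Submodule.annihilator_iSup,
      Submodule.mem_iInf]
    exact fun S ↦ Module.mem_annihilator.mpr (h S S.2)
  exact hx (by simpa using Submodule.mem_annihilator.mp hann 1 trivial)

theorem MonoidAlgebra.of_sub_one_mul_of_sub_one_ne_zero {k G : Type*} [Field k] [CharZero k]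
    [Group G] {c z : G} (hc : c ≠ 1) (hz : z ≠ 1) : (of k G c - 1) * (of k G z - 1) ≠ 0 := by
  classical
  intro h
  have h1 := congrArg (fun x : k[G] ↦ x.coeff 1) h
  by_cases hcz : c * z = 1 <;>
    simp [sub_mul, mul_sub, one_def, single_mul_single, hc, hz, hcz] at h1

theorem Representation.asAlgebraHom_ofModule' {k G M : Type*} [CommSemiring k] [Monoid G]
    [AddCommMonoid M] [Module k M] [Module k[G] M] [IsScalarTower k k[G] M] (x : k[G]) (m : M) :
    (ofModule' (k := k) (G := G) M).asAlgebraHom x m = x • m := by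
  simp [asAlgebraHom, ofModule']

theorem Representation.isIrreducible_ofModule' {k G M : Type*} [Field k] [Monoid G]
    [AddCommGroup M] [Module k M] [Module k[G] M] [IsScalarTower k k[G] M] [IsSimpleModule k[G] M] :
    (ofModule' (k := k) (G := G) M).IsIrreducible := by
  let e : (ofModule' (k := k) (G := G) M).asModule ≃ₗ[k[G]] M :=
    { (ofModule' (k := k) (G := G) M).asModuleEquiv.toAddEquiv with
      map_smul' := fun r x ↦ asAlgebraHom_ofModule' r _ }
  exact (irreducible_iff_isSimpleModule_asModule _).mpr (IsSimpleModule.congr e)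

/-- Every finite nonabelian group with nontrivial center admits an irreducible
complex character of degree greater than `1` which is not unisingular. -/
theorem exists_nonunisingular_of_center_ne_bot {G : Type} [Group G] [Fintype G]
    (hna : ¬ ∀ a b : G, a * b = b * a) (hz : Subgroup.center G ≠ ⊥) :
    ∃ V : FDRep ℂ G, Simple V ∧ 1 < Module.finrank ℂ V ∧ ¬ V.IsUnisingular := by
  push Not at hna
  obtain ⟨a, b, hab⟩ := hna
  obtain ⟨⟨z, hzc⟩, hz1⟩ := Subgroup.ne_bot_iff_exists_ne_one.mp hz
  have hz1 : z ≠ 1 := fun h ↦ hz1 (Subtype.ext h)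
  have hc : ⁅a, b⁆ ≠ 1 := fun h ↦ hab (commutatorElement_eq_one_iff_mul_comm.mp h)
  obtain ⟨S, hS, s, hs⟩ := IsSemisimpleRing.exists_simple_smul_ne_zero
    (MonoidAlgebra.of_sub_one_mul_of_sub_one_ne_zero (k := ℂ) hc hz1)
  let ρ : Representation ℂ G S := Representation.ofModule' S
  have : ρ.IsIrreducible := Representation.isIrreducible_ofModule'
  have : Module.Finite ℂ ℂ[G] := .equiv (MonoidAlgebra.coeffLinearEquiv ℂ).symm
  have : Module.Finite ℂ S := .trans ℂ[G] S
  have hne : (ρ ⁅a, b⁆ - 1) * (ρ z - 1) ≠ 0 := fun h ↦ hs <| by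
    rw [← Representation.asAlgebraHom_ofModule', map_mul, map_sub, map_sub, map_one,
      Representation.asAlgebraHom_of, Representation.asAlgebraHom_of, h, LinearMap.zero_apply]
  refine ⟨FDRep.of ρ, FDRep.simple_of_isIrreducible ρ, ?_, fun hu ↦ hne ?_⟩
  · by_contra! hle
    have hab' : ρ ⁅a, b⁆ = 1 := by
      rw [commutatorElement_def, map_mul, map_mul, map_mul,
        (Module.End.commute_of_finrank_le_one hle (ρ a) (ρ b)).eq, ← map_mul, ← map_mul, ← map_mul]
      simp
    exact hne (by rw [hab', sub_self, zero_mul])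
  · have hρz : ρ z = 1 := LinearMap.ext fun v ↦ by
      simpa using Representation.IsIrreducible.apply_eq_smul_of_hasEigenvalue (ρ := ρ)
        (Subgroup.mem_center_iff.mp hzc) (hu z) v
    rw [hρz, sub_self, mul_zero]
end

section
/- Let x, y, z, m be positive integers such that x ≤ y ≤ z, none of x, y, z equals m, x, y, z are pairwise coprime, and the product x·y·z divides m. If m > 6, then x + y + z < m. -/
/-- If `x ≤ y ≤ z` are positive integers, none equal to `m`, pairwise coprime,
with `x * y * z ∣ m` and `m > 6`, then `x + y + z < m`. -/
theorem add_three_lt_of_pairwise_coprime_dvd (x y z m : ℕ)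
    (hx : 0 < x) (hy : 0 < y) (hz : 0 < z) (hm : 0 < m)
    (hxy : x ≤ y) (hyz : y ≤ z)
    (hxm : x ≠ m) (hym : y ≠ m) (hzm : z ≠ m)
    (cxy : Nat.Coprime x y) (cxz : Nat.Coprime x z) (cyz : Nat.Coprime y z)
    (hdvd : x * y * z ∣ m) (h6 : 6 < m) :
    x + y + z < m := by
  have hle : x * y * z ≤ m := Nat.le_of_dvd hm hdvd
  have ne_of_coprime : ∀ {a b : ℕ}, 2 ≤ a → Nat.Coprime a b → a ≠ b := by
    rintro a _ ha h rfl
    have := (Nat.coprime_self a).1 h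
    omega
  obtain rfl | hx2 : x = 1 ∨ 2 ≤ x := by omega
  · obtain rfl | hy2 : y = 1 ∨ 2 ≤ y := by omega
    · obtain ⟨k, rfl⟩ := hdvd
      have hk : 2 ≤ k := by
        by_contra! hk
        interval_cases k <;> simp_all
      nlinarith
    · have := ne_of_coprime hy2 cyz
      by_cases hz3 : z = 3
      · omega
      · have : 4 ≤ z := by omega
        nlinarith
  · have := ne_of_coprime hx2 cxy
    have hxy6 : 6 ≤ x * y := Nat.mul_le_mul hx2 (by omega : 3 ≤ y)
    nlinarith [Nat.mul_le_mul_right z hxy6]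
end

section
/- Let q be a prime power and let χ be an irreducible complex character of PSL_2(q). Then χ is not unisingular if and only if one of the following cases occurs: (1) q ∈ {2,3} and χ is a nontrivial character of degree 1; (2) q is even and χ(1) = q; (3) q is an odd prime and χ(1) = q−1; (4) q > 3 is an odd prime with q ≡ 3 (mod 4) and χ(1) = (q−1)/2. -/
open Module FDRep Matrix CategoryTheory

/-- `PSL₂(F)`, the projective special linear group of degree 2 over `F`:
the quotient of `SL₂(F)` by its center. -/
abbrev PSL2 (F : Type) [Field F] : Type _ :=
  Matrix.ProjectiveSpecialLinearGroup (Fin 2) F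

namespace SL2

variable {F : Type} [Field F]

/-- The determinant one matrix with rows `(a, b)` and `(c, d)`. -/
def ofEntries (a b c d : F) (h : a * d - b * c = 1) : SpecialLinearGroup (Fin 2) F :=
  ⟨!![a, b; c, d], by rw [det_fin_two_of, h]⟩

@[simp] theorem ofEntries_apply (a b c d : F) (h : a * d - b * c = 1) (i j : Fin 2) :
    ofEntries a b c d h i j = !![a, b; c, d] i j := rfl

/-- The upper unipotent matrix with off-diagonal entry `x`. -/
def upper (x : F) : SpecialLinearGroup (Fin 2) F := ofEntries 1 x 0 1 (by simp)

/-- The diagonal matrix with entries `r` and `r⁻¹`. -/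
def torus (r : Fˣ) : SpecialLinearGroup (Fin 2) F := ofEntries (r : F) 0 0 (r : F)⁻¹ (by simp)

/-- The standard representative of the nontrivial Weyl group element. -/
def weyl : SpecialLinearGroup (Fin 2) F := ofEntries 0 1 (-1) 0 (by simp)

theorem det_eq (g : SpecialLinearGroup (Fin 2) F) : g 0 0 * g 1 1 - g 0 1 * g 1 0 = 1 := by
  have := g.det_coe; rwa [det_fin_two] at this

/-- The anti-involution of `SL₂` reflecting a matrix in its antidiagonal. -/
def flip (g : SpecialLinearGroup (Fin 2) F) : SpecialLinearGroup (Fin 2) F :=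
  ofEntries (g 1 1) (g 0 1) (g 1 0) (g 0 0) (by linear_combination det_eq g)

@[simp] theorem mul_apply' (g h : SpecialLinearGroup (Fin 2) F) (i j : Fin 2) :
    (g * h) i j = g i 0 * h 0 j + g i 1 * h 1 j :=
  (Matrix.mul_apply ..).trans (Fin.sum_univ_two _)

theorem inv_eq (g : SpecialLinearGroup (Fin 2) F) : g⁻¹ =
    ofEntries (g 1 1) (-g 0 1) (-g 1 0) (g 0 0) (by linear_combination det_eq g) :=
  Subtype.ext (adjugate_fin_two _)

@[simp] theorem inv_apply_zero_zero (g : SpecialLinearGroup (Fin 2) F) : g⁻¹ 0 0 = g 1 1 := by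
  rw [inv_eq]; rfl
@[simp] theorem inv_apply_zero_one (g : SpecialLinearGroup (Fin 2) F) : g⁻¹ 0 1 = -g 0 1 := by
  rw [inv_eq]; rfl
@[simp] theorem inv_apply_one_zero (g : SpecialLinearGroup (Fin 2) F) : g⁻¹ 1 0 = -g 1 0 := by
  rw [inv_eq]; rfl
@[simp] theorem inv_apply_one_one (g : SpecialLinearGroup (Fin 2) F) : g⁻¹ 1 1 = g 0 0 := by
  rw [inv_eq]; rfl

@[simp] theorem one_apply' (i j : Fin 2) :
    (1 : SpecialLinearGroup (Fin 2) F) i j = (1 : Matrix (Fin 2) (Fin 2) F) i j := rfl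
@[simp] theorem neg_apply' (g : SpecialLinearGroup (Fin 2) F) (i j : Fin 2) :
    (-g) i j = -g i j := rfl

theorem ext_iff_entries {g h : SpecialLinearGroup (Fin 2) F} :
    g = h ↔ g 0 0 = h 0 0 ∧ g 0 1 = h 0 1 ∧ g 1 0 = h 1 0 ∧ g 1 1 = h 1 1 := by
  constructor
  · rintro rfl; simp
  · rintro ⟨h1, h2, h3, h4⟩
    refine Matrix.SpecialLinearGroup.ext g h fun i j => ?_
    fin_cases i <;> fin_cases j <;> assumption

@[simp] theorem upper_zero : upper (0 : F) = 1 := by simp [ext_iff_entries, upper]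
theorem upper_add (x y : F) : upper (x + y) = upper x * upper y := by
  simp [ext_iff_entries, upper, add_comm]
theorem upper_neg (x : F) : upper (-x) = (upper x)⁻¹ := by simp [ext_iff_entries, upper]
@[simp] theorem torus_one : torus (1 : Fˣ) = 1 := by simp [ext_iff_entries, torus]
theorem torus_mul (r s : Fˣ) : torus (r * s) = torus r * torus s := by
  simp [ext_iff_entries, torus, mul_comm]
theorem torus_mul_upper (r : Fˣ) (x : F) :
    torus r * upper x = upper ((r : F) ^ 2 * x) * torus r := by
  simp [ext_iff_entries, upper, torus]; field_simp
theorem torus_mul_weyl (r : Fˣ) : torus r * weyl = weyl * torus r⁻¹ := by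
  simp [ext_iff_entries, torus, weyl]
theorem weyl_mul_weyl : weyl * weyl = (-1 : SpecialLinearGroup (Fin 2) F) := by
  simp [ext_iff_entries, weyl]
theorem torus_neg_one : torus (-1 : Fˣ) = -1 := by
  simp [ext_iff_entries, torus, ← one_div]
theorem weyl_mul_upper_mul_weyl (x : Fˣ) :
    weyl * upper (x : F) * weyl =
      upper (-(x : F)⁻¹) * torus (-x⁻¹) * weyl * upper (-(x : F)⁻¹) := by
  simp [ext_iff_entries, upper, torus, weyl, inv_neg]

theorem flip_mul (g h : SpecialLinearGroup (Fin 2) F) : flip (g * h) = flip h * flip g := by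
  simp only [ext_iff_entries, flip, mul_apply', ofEntries_apply]
  simp; ring_nf; simp
@[simp] theorem flip_upper (x : F) : flip (upper x) = upper x := by
  simp [upper, flip]
theorem flip_torus_mul_weyl (r : Fˣ) : flip (torus r * weyl) = torus r * weyl := by
  simp [ext_iff_entries, torus, weyl, flip]
theorem flip_torus (r : Fˣ) : flip (torus r) = torus r⁻¹ := by
  simp [torus, flip]

theorem exists_eq_torus_mul_upper {g : SpecialLinearGroup (Fin 2) F} (h : g 1 0 = 0) :
    ∃ r x, g = torus r * upper x ∧ (r : F) = g 0 0 := by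
  have hd := det_eq g
  rw [h, mul_zero, sub_zero] at hd
  have h0 : g 0 0 ≠ 0 := left_ne_zero_of_mul_eq_one hd
  refine ⟨Units.mk0 _ h0, (g 0 0)⁻¹ * g 0 1, ?_, rfl⟩
  simp only [ext_iff_entries, torus, upper, mul_apply', ofEntries_apply]
  simp [h, h0]
  exact eq_inv_of_mul_eq_one_right hd

theorem exists_eq_upper_mul_torus_mul_weyl_mul_upper {g : SpecialLinearGroup (Fin 2) F}
    (h : g 1 0 ≠ 0) : ∃ x r y, g = upper x * (torus r * weyl) * upper y := by
  have hd := det_eq g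
  refine ⟨g 0 0 / g 1 0, -(Units.mk0 _ h)⁻¹, g 1 1 / g 1 0, ?_⟩
  simp only [ext_iff_entries, torus, upper, weyl, mul_apply', ofEntries_apply]
  simp [h]
  constructor
  · field_simp; linear_combination -hd
  · field_simp

/-- A subgroup containing the upper unipotent matrices and `weyl` is everything. -/
theorem eq_top_of_upper_of_weyl {H : Subgroup (SpecialLinearGroup (Fin 2) F)}
    (hu : ∀ x, upper x ∈ H) (hw : weyl ∈ H) : H = ⊤ := by
  have ht : ∀ r : Fˣ, torus r ∈ H := by
    intro r
    have h2 : torus r = (upper (r : F))⁻¹ * (weyl * upper (-(r : F)⁻¹) * weyl) *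
        (weyl * upper (r : F))⁻¹ := by
      have h := weyl_mul_upper_mul_weyl (-r⁻¹)
      simp only [inv_neg, inv_inv, neg_neg, Units.val_neg, Units.val_inv_eq_inv_val] at h
      rw [h]; group
    rw [h2]
    exact H.mul_mem (H.mul_mem (H.inv_mem (hu _)) (H.mul_mem (H.mul_mem hw (hu _)) hw))
      (H.inv_mem (H.mul_mem hw (hu _)))
  rw [eq_top_iff]
  intro g _
  by_cases h : g 1 0 = 0
  · obtain ⟨r, x, rfl, -⟩ := exists_eq_torus_mul_upper h
    exact H.mul_mem (ht _) (hu _)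
  · obtain ⟨x, r, y, rfl⟩ := exists_eq_upper_mul_torus_mul_weyl_mul_upper h
    exact H.mul_mem (H.mul_mem (hu _) (H.mul_mem (ht _) hw)) (hu _)

section weights

variable {F : Type} [Field F] {V : Type*} [AddCommGroup V] [Module ℂ V]
  (ρ : Representation ℂ (SpecialLinearGroup (Fin 2) F) V) (ψ : AddChar F ℂ)

/-- The vectors on which the unipotent group acts through the character `x ↦ ψ (a * x)`. -/
def weightSpace (a : F) : Submodule ℂ V where
  carrier := {v | ∀ x, ρ (upper x) v = ψ (a * x) • v}
  add_mem' hv hw x := by rw [map_add, hv x, hw x, smul_add]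
  zero_mem' x := by simp
  smul_mem' c v hv x := by rw [map_smul, hv x, smul_comm]

variable {ρ ψ} in
theorem mem_weightSpace {a : F} {v : V} :
    v ∈ weightSpace ρ ψ a ↔ ∀ x, ρ (upper x) v = ψ (a * x) • v := Iff.rfl

variable {ρ ψ} in
theorem mem_weightSpace_zero {v : V} :
    v ∈ weightSpace ρ ψ 0 ↔ ∀ x, ρ (upper x) v = v := by simp [mem_weightSpace]

variable [Fintype F]

/-- The projection onto the weight space of `a`. -/
noncomputable def weightProj (a : F) : End ℂ V :=
  (Fintype.card F : ℂ)⁻¹ • ∑ x, ψ (-(a * x)) • ρ (upper x)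

theorem weightProj_apply (a : F) (v : V) :
    weightProj ρ ψ a v = (Fintype.card F : ℂ)⁻¹ • ∑ x, ψ (-(a * x)) • ρ (upper x) v := by
  simp [weightProj, LinearMap.sum_apply]

theorem upper_mul_weightProj (a y : F) :
    ρ (upper y) * weightProj ρ ψ a = ψ (a * y) • weightProj ρ ψ a := by
  rw [weightProj, smul_comm (ψ (a * y))]
  simp only [mul_smul_comm, Finset.mul_sum, ← map_mul, ← upper_add, Finset.smul_sum, smul_smul]
  refine Fintype.sum_equiv (Equiv.addLeft y) _ _ fun x => ?_
  simp only [Equiv.coe_addLeft, ← AddChar.map_add_eq_mul]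
  congr 3; ring_nf

theorem weightProj_mul_upper (a y : F) :
    weightProj ρ ψ a * ρ (upper y) = ψ (a * y) • weightProj ρ ψ a := by
  rw [← upper_mul_weightProj]
  simp only [weightProj, mul_smul_comm, smul_mul_assoc, Finset.mul_sum, Finset.sum_mul, ← map_mul,
    ← upper_add, add_comm]

theorem weightProj_apply_of_mem {a : F} {v : V} (hv : v ∈ weightSpace ρ ψ a) :
    weightProj ρ ψ a v = v := by
  rw [weightProj_apply]
  simp_rw [mem_weightSpace.1 hv, smul_smul, ← AddChar.map_add_eq_mul, neg_add_cancel]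
  simp [← Nat.cast_smul_eq_nsmul ℂ, smul_smul]

theorem isProj_weightProj (a : F) :
    LinearMap.IsProj (weightSpace ρ ψ a) (weightProj ρ ψ a) where
  map_mem v y := by
    rw [← Module.End.mul_apply, upper_mul_weightProj]; rfl
  map_id v hv := weightProj_apply_of_mem ρ ψ hv

theorem weightProj_mem (a : F) (v : V) : weightProj ρ ψ a v ∈ weightSpace ρ ψ a :=
  (isProj_weightProj ρ ψ a).map_mem v

theorem trace_weightProj [FiniteDimensional ℂ V] (a : F) :
    LinearMap.trace ℂ V (weightProj ρ ψ a) = finrank ℂ (weightSpace ρ ψ a) :=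
  (isProj_weightProj ρ ψ a).trace

variable {ψ} in
theorem weightProj_apply_of_mem_of_ne (hψ : ψ.IsPrimitive) {a b : F} (hab : a ≠ b) {v : V}
    (hv : v ∈ weightSpace ρ ψ b) : weightProj ρ ψ a v = 0 := by
  classical
  rw [weightProj_apply]
  simp_rw [mem_weightSpace.1 hv, smul_smul, ← AddChar.map_add_eq_mul]
  rw [← Finset.sum_smul]
  have := AddChar.sum_mulShift (b - a) hψ
  rw [if_neg (sub_ne_zero.2 hab.symm)] at this
  rw [show (∑ x, ψ (-(a * x) + b * x)) = ∑ x, ψ (x * (b - a)) from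
    Finset.sum_congr rfl fun x _ => by ring_nf, this]
  simp

variable {ψ} in
theorem weightProj_mul_weightProj_of_ne (hψ : ψ.IsPrimitive) {a b : F} (hab : a ≠ b) :
    weightProj ρ ψ a * weightProj ρ ψ b = 0 :=
  LinearMap.ext fun v => weightProj_apply_of_mem_of_ne ρ hψ hab (weightProj_mem ρ ψ b v)

theorem weightProj_mul_self (a : F) :
    weightProj ρ ψ a * weightProj ρ ψ a = weightProj ρ ψ a :=
  LinearMap.ext fun v => weightProj_apply_of_mem ρ ψ (weightProj_mem ρ ψ a v)

variable {ψ} in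
theorem sum_weightProj (hψ : ψ.IsPrimitive) : ∑ a, weightProj ρ ψ a = 1 := by
  classical
  simp only [weightProj, ← Finset.smul_sum]
  rw [Finset.sum_comm]
  simp_rw [← Finset.sum_smul]
  have (x : F) : ∑ a, ψ (-(a * x)) = if x = 0 then (Fintype.card F : ℂ) else 0 := by
    have := AddChar.sum_mulShift (-x) hψ
    simp only [neg_eq_zero] at this
    rw [Nat.cast_ite, Nat.cast_zero] at this
    rw [← this]
    simp [mul_comm]
  simp [this, smul_smul]

variable {ψ} in
theorem sum_finrank_weightSpace [FiniteDimensional ℂ V] (hψ : ψ.IsPrimitive) :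
    ∑ a, finrank ℂ (weightSpace ρ ψ a) = finrank ℂ V := by
  have := congrArg (LinearMap.trace ℂ V) (sum_weightProj ρ hψ)
  rw [map_sum, LinearMap.trace_one] at this
  simp_rw [trace_weightProj] at this
  exact_mod_cast this

theorem torus_mul_weightProj (r : Fˣ) (a : F) :
    ρ (torus r) * weightProj ρ ψ (a * (r : F) ^ 2) = weightProj ρ ψ a * ρ (torus r) := by
  simp only [weightProj, mul_smul_comm, smul_mul_assoc, Finset.mul_sum, Finset.sum_mul, ← map_mul,
    torus_mul_upper]
  congr 1
  refine Fintype.sum_equiv (Equiv.mulLeft₀ ((r : F) ^ 2) (by simp)) _ _ fun x => ?_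
  simp only [Equiv.mulLeft₀_apply, mul_assoc]

theorem torus_mul_weightProj_zero (r : Fˣ) :
    ρ (torus r) * weightProj ρ ψ 0 = weightProj ρ ψ 0 * ρ (torus r) := by
  simpa using torus_mul_weightProj ρ ψ r 0

omit [Fintype F] in
theorem torus_mem_weightSpace (r : Fˣ) {a : F} {v : V}
    (hv : v ∈ weightSpace ρ ψ (a * (r : F) ^ 2)) : ρ (torus r) v ∈ weightSpace ρ ψ a := by
  intro x
  have h : upper x * torus r = torus r * upper (((r : F) ^ 2)⁻¹ * x) := by
    rw [torus_mul_upper, mul_inv_cancel_left₀ (by simp)]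
  rw [← Module.End.mul_apply, ← map_mul, h, map_mul, Module.End.mul_apply, hv, map_smul]
  congr 2
  field_simp

theorem finrank_weightSpace_mul_sq [FiniteDimensional ℂ V] (r : Fˣ) (a : F) :
    finrank ℂ (weightSpace ρ ψ (a * (r : F) ^ 2)) = finrank ℂ (weightSpace ρ ψ a) := by
  have h : weightProj ρ ψ (a * (r : F) ^ 2) =
      ρ (torus r)⁻¹ * (weightProj ρ ψ a * ρ (torus r)) := by
    rw [← torus_mul_weightProj, ← mul_assoc, ← map_mul]
    simp
  have h2 := congrArg (LinearMap.trace ℂ V) h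
  rw [LinearMap.trace_mul_comm, mul_assoc, ← map_mul] at h2
  simp only [mul_inv_cancel, map_one, mul_one, trace_weightProj] at h2
  exact_mod_cast h2

end weights

end SL2

theorem Representation.IsIrreducible.eq_top_of_forall_mem {k G V : Type*} [Group G] [Field k]
    [AddCommGroup V] [Module k V] {ρ : Representation k G V} (hρ : ρ.IsIrreducible)
    {v : V} (hv : v ≠ 0) {W : Submodule k V} (hW : ∀ g, ρ g v ∈ W) : W = ⊤ := by
  let S : Subrepresentation ρ :=
    ⟨Submodule.span k (Set.range fun g => ρ g v), fun g w hw => by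
      induction hw using Submodule.span_induction with
      | mem x hx =>
        obtain ⟨h, rfl⟩ := hx
        exact Submodule.subset_span ⟨g * h, by simp⟩
      | zero => simp
      | add x y _ _ hx hy => rw [map_add]; exact Submodule.add_mem _ hx hy
      | smul c x _ hx => rw [map_smul]; exact Submodule.smul_mem _ _ hx⟩
  have hS : Submodule.span k (Set.range fun g => ρ g v) = ⊤ := by
    rcases eq_bot_or_eq_top S with h | h
    · have h1 : v ∈ S.toSubmodule := Submodule.subset_span ⟨1, by simp⟩
      rw [h] at h1
      exact absurd h1 hv
    · exact congrArg Subrepresentation.toSubmodule h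
  rw [eq_top_iff, ← hS, Submodule.span_le]
  rintro _ ⟨g, rfl⟩
  exact hW g

namespace SL2

section multiplicity

variable {F : Type} [Field F] [Fintype F] {V : Type*} [AddCommGroup V] [Module ℂ V]
  (ρ : Representation ℂ (SpecialLinearGroup (Fin 2) F) V) {ψ : AddChar F ℂ}

theorem hecke_flip (hψ : ψ.IsPrimitive) {a : F} (ha : a ≠ 0)
    (g : SpecialLinearGroup (Fin 2) F) :
    weightProj ρ ψ a * ρ (flip g) * weightProj ρ ψ a =
      weightProj ρ ψ a * ρ g * weightProj ρ ψ a := by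
  by_cases h : g 1 0 = 0
  · obtain ⟨r, x, rfl, -⟩ := exists_eq_torus_mul_upper h
    simp only [flip_mul, flip_upper, flip_torus, map_mul]
    simp only [← mul_assoc, weightProj_mul_upper]
    rw [mul_assoc _ (ρ (upper x)), upper_mul_weightProj]
    simp only [smul_mul_assoc, mul_smul_comm]
    congr 1
    by_cases hr : (r : F) ^ 2 = 1
    · rw [show r⁻¹ = r from inv_eq_of_mul_eq_one_left (Units.ext (by simpa [sq] using hr))]
    · rw [← torus_mul_weightProj, ← torus_mul_weightProj, mul_assoc, mul_assoc,
        weightProj_mul_weightProj_of_ne ρ hψ, weightProj_mul_weightProj_of_ne ρ hψ]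
      · simp
      · simpa [ha] using hr
      · simpa [ha] using hr
  · obtain ⟨x, r, y, rfl⟩ := exists_eq_upper_mul_torus_mul_weyl_mul_upper h
    have hs := flip_torus_mul_weyl r
    generalize torus r * weyl = s at hs
    simp only [flip_mul, flip_upper, hs, map_mul, ← mul_assoc, weightProj_mul_upper]
    rw [mul_assoc _ _ (weightProj ρ ψ a), mul_assoc _ _ (weightProj ρ ψ a),
      upper_mul_weightProj, upper_mul_weightProj]
    simp only [smul_mul_assoc, mul_smul_comm]
    rw [smul_comm]

theorem hecke_mul (ψ : AddChar F ℂ) (a : F) (g h : SpecialLinearGroup (Fin 2) F) :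
    weightProj ρ ψ a * ρ g * weightProj ρ ψ a * (ρ h * weightProj ρ ψ a) =
      (Fintype.card F : ℂ)⁻¹ • ∑ x, ψ (-(a * x)) •
        (weightProj ρ ψ a * ρ (g * upper x * h) * weightProj ρ ψ a) := by
  have : weightProj ρ ψ a * ρ g * weightProj ρ ψ a * (ρ h * weightProj ρ ψ a) =
    weightProj ρ ψ a * (ρ g * ((Fintype.card F : ℂ)⁻¹ • ∑ x, ψ (-(a * x)) • ρ (upper x)) * ρ h)
      * weightProj ρ ψ a := by
    simp only [mul_assoc]; rfl
  rw [this]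
  simp only [mul_smul_comm, smul_mul_assoc, Finset.mul_sum, Finset.sum_mul, map_mul]

theorem hecke_comm (hψ : ψ.IsPrimitive) {a : F} (ha : a ≠ 0)
    (g h : SpecialLinearGroup (Fin 2) F) :
    weightProj ρ ψ a * ρ g * weightProj ρ ψ a * (ρ h * weightProj ρ ψ a) =
      weightProj ρ ψ a * ρ h * weightProj ρ ψ a * (ρ g * weightProj ρ ψ a) := by
  have aux (g h : SpecialLinearGroup (Fin 2) F) :
      weightProj ρ ψ a * ρ g * weightProj ρ ψ a * (ρ h * weightProj ρ ψ a) =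
        (weightProj ρ ψ a * ρ g * weightProj ρ ψ a) *
          (weightProj ρ ψ a * ρ h * weightProj ρ ψ a) := by
    conv_lhs => rw [← weightProj_mul_self ρ ψ a]
    simp only [mul_assoc]
    simp only [← mul_assoc, weightProj_mul_self]
  refine Eq.trans ?_ ((aux (flip h) (flip g)).trans ?_)
  swap
  · rw [hecke_flip ρ hψ ha g, hecke_flip ρ hψ ha h, aux h g]
  rw [hecke_mul, hecke_mul]
  congr 1
  refine Finset.sum_congr rfl fun x _ => ?_
  rw [← hecke_flip ρ hψ ha (g * upper x * h), flip_mul, flip_mul, flip_upper, mul_assoc (flip h)]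

/-- Irreducible representations of `SL₂` have at most one Whittaker vector up to scaling. -/
theorem finrank_weightSpace_le_one [FiniteDimensional ℂ V] (hρ : ρ.IsIrreducible)
    (hψ : ψ.IsPrimitive) {a : F} (ha : a ≠ 0) : finrank ℂ (weightSpace ρ ψ a) ≤ 1 := by
  by_cases hbot : weightSpace ρ ψ a = ⊥
  · rw [hbot, finrank_bot]; exact zero_le_one
  obtain ⟨v, hv, hv0⟩ := Submodule.exists_mem_ne_zero_of_ne_bot hbot
  set e := weightProj ρ ψ a with he
  have hscalar (h) : ∃ μ : ℂ, ∀ w, e (ρ h (e w)) = μ • e w := by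
    have : Nontrivial (weightSpace ρ ψ a) := ⟨⟨v, hv⟩, 0, fun h => hv0 (by simpa using h)⟩
    obtain ⟨μ, hμ⟩ := End.exists_eigenvalue ((e * ρ h).restrict (p := weightSpace ρ ψ a)
      (q := weightSpace ρ ψ a) fun v _ => weightProj_mem ρ ψ a _)
    obtain ⟨⟨w, hw⟩, hw2⟩ := hμ.exists_hasEigenvector
    have hw0 : w ≠ 0 := fun h => hw2.2 (Subtype.ext h)
    have hμw : e (ρ h w) = μ • w := congrArg Subtype.val hw2.apply_eq_smul
    have hew : e w = w := weightProj_apply_of_mem ρ ψ hw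
    refine ⟨μ, fun z => ?_⟩
    have key := hρ.eq_top_of_forall_mem hw0 (W := LinearMap.ker (e * ρ h * e - μ • e)) fun g => by
      have := LinearMap.congr_fun (hecke_comm ρ hψ ha h g) w
      simp only [Module.End.mul_apply, ← he, hew, hμw] at this
      simp [this]
    have hz : z ∈ LinearMap.ker (e * ρ h * e - μ • e) := key ▸ Submodule.mem_top
    simpa [sub_eq_zero] using hz
  have key := hρ.eq_top_of_forall_mem hv0 (W := (Submodule.span ℂ {v}).comap e) fun g => by
    obtain ⟨μ, hμ⟩ := hscalar g
    have := hμ v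
    rw [weightProj_apply_of_mem ρ ψ hv] at this
    rw [Submodule.mem_comap, this]
    exact Submodule.smul_mem _ _ (Submodule.mem_span_singleton_self v)
  have hle : weightSpace ρ ψ a ≤ Submodule.span ℂ {v} := fun w hw => by
    have hz : w ∈ (Submodule.span ℂ {v}).comap e := key ▸ Submodule.mem_top
    rwa [Submodule.mem_comap, weightProj_apply_of_mem ρ ψ hw] at hz
  exact (Submodule.finrank_mono hle).trans (finrank_span_singleton hv0).le

end multiplicity

theorem sum_eq_add_sum_units {F M : Type*} [Field F] [Fintype F] [DecidableEq F] [AddCommMonoid M]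
    (f : F → M) : ∑ x, f x = f 0 + ∑ x : Fˣ, f x := by
  rw [Fintype.sum_eq_add_sum_subtype_ne _ (0 : F)]
  exact congrArg _ (Fintype.sum_equiv unitsEquivNeZero _ _ fun _ => rfl).symm

section torus

variable {F : Type} [Field F] {V : Type*} [AddCommGroup V] [Module ℂ V]
  (ρ : Representation ℂ (SpecialLinearGroup (Fin 2) F) V) (ψ : AddChar F ℂ)

/-- The vectors fixed by the diagonal torus. -/
def torusFixed : Submodule ℂ V where
  carrier := {v | ∀ r, ρ (torus r) v = v}
  add_mem' hv hw r := by rw [map_add, hv r, hw r]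
  zero_mem' r := by simp
  smul_mem' c v hv r := by rw [map_smul, hv r]

variable {ρ} in
theorem mem_torusFixed {v : V} : v ∈ torusFixed ρ ↔ ∀ r, ρ (torus r) v = v := Iff.rfl

/-- The vectors fixed by the upper triangular Borel subgroup. -/
def borelFixed : Submodule ℂ V := torusFixed ρ ⊓ weightSpace ρ ψ 0

variable [Fintype F] [DecidableEq F]

/-- The projection onto the vectors fixed by the torus. -/
noncomputable def torusProj : End ℂ V :=
  (Fintype.card Fˣ : ℂ)⁻¹ • ∑ r, ρ (torus r)

theorem torusProj_apply (v : V) :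
    torusProj ρ v = (Fintype.card Fˣ : ℂ)⁻¹ • ∑ r, ρ (torus r) v := by
  simp [torusProj, LinearMap.sum_apply]

theorem torus_mul_torusProj (r : Fˣ) : ρ (torus r) * torusProj ρ = torusProj ρ := by
  simp only [torusProj, mul_smul_comm, Finset.mul_sum, ← map_mul, ← torus_mul]
  congr 1
  exact Fintype.sum_equiv (Equiv.mulLeft r) _ _ fun _ => rfl

theorem isProj_torusProj : LinearMap.IsProj (torusFixed ρ) (torusProj ρ) where
  map_mem v r := by rw [← Module.End.mul_apply, torus_mul_torusProj]
  map_id v hv := by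
    rw [torusProj_apply]
    simp_rw [mem_torusFixed.1 hv]
    simp [← Nat.cast_smul_eq_nsmul ℂ, smul_smul]

theorem torusProj_mul_weightProj_zero :
    torusProj ρ * weightProj ρ ψ 0 = weightProj ρ ψ 0 * torusProj ρ := by
  simp only [torusProj, smul_mul_assoc, mul_smul_comm, Finset.mul_sum, Finset.sum_mul,
    torus_mul_weightProj_zero]

theorem isProj_borel :
    LinearMap.IsProj (borelFixed ρ ψ) (torusProj ρ * weightProj ρ ψ 0) where
  map_mem v := ⟨(isProj_torusProj ρ).map_mem _, by
    rw [torusProj_mul_weightProj_zero]; exact weightProj_mem ρ ψ 0 _⟩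
  map_id v hv := by
    rw [Module.End.mul_apply, weightProj_apply_of_mem ρ ψ hv.2, (isProj_torusProj ρ).map_id v hv.1]

variable [FiniteDimensional ℂ V]

theorem sum_trace_torus :
    ∑ r, LinearMap.trace ℂ V (ρ (torus r)) = Fintype.card Fˣ * finrank ℂ (torusFixed ρ) := by
  rw [← (isProj_torusProj ρ).trace, torusProj, map_smul, map_sum, smul_eq_mul,
    mul_inv_cancel_left₀ (by simp)]

theorem sum_trace_torus_mul_weightProj_zero :
    ∑ r, LinearMap.trace ℂ V (ρ (torus r) * weightProj ρ ψ 0) =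
      Fintype.card Fˣ * finrank ℂ (borelFixed ρ ψ) := by
  rw [← (isProj_borel ρ ψ).trace, torusProj, smul_mul_assoc, Finset.sum_mul, map_smul, map_sum,
    smul_eq_mul, mul_inv_cancel_left₀ (by simp)]

theorem sum_trace_borel :
    ∑ r, ∑ x, LinearMap.trace ℂ V (ρ (torus r * upper x)) =
      Fintype.card F * Fintype.card Fˣ * finrank ℂ (borelFixed ρ ψ) := by
  rw [mul_assoc, ← sum_trace_torus_mul_weightProj_zero, Finset.mul_sum]
  refine Finset.sum_congr rfl fun r _ => ?_
  simp [weightProj, Finset.mul_sum]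

variable {ψ}

omit [DecidableEq F] [FiniteDimensional ℂ V] in
theorem trace_torus_mul_weightProj (hψ : ψ.IsPrimitive) {r : Fˣ} (hr : (r : F) ^ 2 ≠ 1) {a : F}
    (ha : a ≠ 0) : LinearMap.trace ℂ V (ρ (torus r) * weightProj ρ ψ a) = 0 := by
  rw [← weightProj_mul_self, ← mul_assoc, LinearMap.trace_mul_comm, ← mul_assoc,
    ← torus_mul_weightProj, mul_assoc, weightProj_mul_weightProj_of_ne ρ hψ fun h =>
      hr (mul_left_cancel₀ ha (h.trans (mul_one a).symm))]
  simp

omit [DecidableEq F] [FiniteDimensional ℂ V] in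
theorem trace_torus (hψ : ψ.IsPrimitive) {r : Fˣ} (hr : (r : F) ^ 2 ≠ 1) :
    LinearMap.trace ℂ V (ρ (torus r)) =
      LinearMap.trace ℂ V (ρ (torus r) * weightProj ρ ψ 0) := by
  conv_lhs => rw [← mul_one (ρ (torus r)), ← sum_weightProj ρ hψ, Finset.mul_sum, map_sum]
  exact Finset.sum_eq_single 0 (fun a _ ha => trace_torus_mul_weightProj ρ hψ hr ha) (by simp)

omit [Fintype F] [DecidableEq F] [FiniteDimensional ℂ V] in
theorem map_torus_eq_one (hneg : ρ (-1) = 1) {r : Fˣ} (hr : (r : F) ^ 2 = 1) :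
    ρ (torus r) = 1 := by
  rcases sq_eq_one_iff.1 hr with h | h
  · rw [show r = 1 from Units.ext h]; simp
  · rw [show r = -1 from Units.ext h, torus_neg_one, hneg]

/-- The comparison of the torus fixed vectors with the weights of the unipotent group. -/
theorem card_mul_finrank_torusFixed (hψ : ψ.IsPrimitive) (hneg : ρ (-1) = 1) :
    Fintype.card Fˣ * finrank ℂ (torusFixed ρ) =
      Fintype.card Fˣ * finrank ℂ (borelFixed ρ ψ) +
        Fintype.card {r : Fˣ // (r : F) ^ 2 = 1} *
          ∑ a : Fˣ, finrank ℂ (weightSpace ρ ψ (a : F)) := by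
  have hdim : (finrank ℂ V : ℂ) = finrank ℂ (weightSpace ρ ψ 0) +
      ((∑ a : Fˣ, finrank ℂ (weightSpace ρ ψ (a : F)) : ℕ) : ℂ) := by
    rw [← sum_finrank_weightSpace ρ hψ, ← Nat.cast_add, sum_eq_add_sum_units]
  have key (r : Fˣ) : LinearMap.trace ℂ V (ρ (torus r)) =
      LinearMap.trace ℂ V (ρ (torus r) * weightProj ρ ψ 0) + if (r : F) ^ 2 = 1 then
        ((∑ a : Fˣ, finrank ℂ (weightSpace ρ ψ (a : F)) : ℕ) : ℂ) else 0 := by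
    split_ifs with hr
    · rw [map_torus_eq_one ρ hneg hr, one_mul, trace_weightProj, LinearMap.trace_one, hdim]
    · rw [trace_torus ρ hψ hr, add_zero]
  have := sum_trace_torus ρ
  simp_rw [key, Finset.sum_add_distrib, sum_trace_torus_mul_weightProj_zero] at this
  rw [← Finset.sum_filter, Finset.sum_const, ← Fintype.card_subtype, nsmul_eq_mul] at this
  exact_mod_cast this.symm

omit [Fintype F] [DecidableEq F] [FiniteDimensional ℂ V] in
theorem map_eq_one_of_weightSpace_zero_eq_top (h : weightSpace ρ ψ 0 = ⊤) (g) : ρ g = 1 := by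
  have hu (x : F) : ρ (upper x) = 1 := LinearMap.ext fun v =>
    mem_weightSpace_zero.1 (h ▸ Submodule.mem_top : v ∈ weightSpace ρ ψ 0) x
  have hker := eq_top_of_upper_of_weyl (H := MonoidHom.ker ρ) hu <| by
    have h1 := congrArg ρ (weyl_mul_upper_mul_weyl (1 : Fˣ))
    rw [map_mul, map_mul, map_mul, map_mul, map_mul, hu, hu, mul_one, mul_one, one_mul, inv_one,
      torus_neg_one, ← weyl_mul_weyl, ← map_mul, ← map_mul] at h1
    rw [MonoidHom.mem_ker, ← inv_mul_cancel_left (weyl * weyl : SpecialLinearGroup (Fin 2) F) weyl,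
      map_mul, ← h1, ← map_mul, inv_mul_cancel, map_one]
  exact MonoidHom.mem_ker.1 (hker ▸ Subgroup.mem_top g)

theorem finrank_borelFixed_lt (hψ : ψ.IsPrimitive) (hneg : ρ (-1) = 1)
    (hnt : ∃ g, ρ g ≠ 1) : finrank ℂ (borelFixed ρ ψ) < finrank ℂ (torusFixed ρ) := by
  obtain ⟨g, hg⟩ := hnt
  have hpos : 0 < ∑ a : Fˣ, finrank ℂ (weightSpace ρ ψ (a : F)) := by
    rw [Nat.pos_iff_ne_zero]
    intro h0
    refine hg (map_eq_one_of_weightSpace_zero_eq_top ρ (ψ := ψ) ?_ g)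
    apply Submodule.eq_top_of_finrank_eq
    rw [← sum_finrank_weightSpace ρ hψ, eq_comm]
    refine Finset.sum_eq_single 0 (fun a _ ha => ?_) (by simp)
    exact Finset.sum_eq_zero_iff.1 h0 (Units.mk0 a ha) (Finset.mem_univ _)
  have h := card_mul_finrank_torusFixed ρ hψ hneg
  have : 0 < Fintype.card {r : Fˣ // (r : F) ^ 2 = 1} := Fintype.card_pos_iff.2 ⟨1, by simp⟩
  refine lt_of_mul_lt_mul_left ?_ (Nat.zero_le (Fintype.card Fˣ))
  rw [h]
  exact Nat.lt_add_of_pos_right (Nat.mul_pos this hpos)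

end torus

section principal

variable {F : Type} [Field F] {V : Type*} [AddCommGroup V] [Module ℂ V]
  {ρ : Representation ℂ (SpecialLinearGroup (Fin 2) F) V} {ψ : AddChar F ℂ}
  {v : V} {χ : Fˣ → ℂ}

theorem map_neg (hneg : ρ (-1) = 1) (g : SpecialLinearGroup (Fin 2) F) : ρ (-g) = ρ g := by
  rw [← neg_one_mul, map_mul, hneg, one_mul]

theorem map_torus_neg (hneg : ρ (-1) = 1) (r : Fˣ) : ρ (torus (-r)) = ρ (torus r) := by
  rw [← neg_one_mul, torus_mul, torus_neg_one, map_mul, hneg, one_mul]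

theorem map_weyl_map_weyl (hneg : ρ (-1) = 1) (z : V) : ρ weyl (ρ weyl z) = z := by
  rw [← Module.End.mul_apply, ← map_mul, weyl_mul_weyl, hneg, Module.End.one_apply]

theorem map_torus_map_weyl (r : Fˣ) (z : V) :
    ρ (torus r) (ρ weyl z) = ρ weyl (ρ (torus r⁻¹) z) := by
  rw [← Module.End.mul_apply, ← Module.End.mul_apply, ← map_mul, ← map_mul, torus_mul_weyl]

theorem map_weyl_upper_weyl (hneg : ρ (-1) = 1) (hv : v ∈ weightSpace ρ ψ 0) (x : Fˣ) :
    ρ weyl (ρ (upper (x : F)) (ρ weyl v)) =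
      ρ (upper (-(x : F)⁻¹)) (ρ weyl (ρ (torus x) v)) := by
  have h := LinearMap.congr_fun (congrArg ρ (weyl_mul_upper_mul_weyl x)) v
  simp only [map_mul, Module.End.mul_apply, mem_weightSpace_zero.1 hv, map_torus_neg hneg,
    map_torus_map_weyl, inv_inv] at h
  exact h

/-- An irreducible representation is spanned by a highest weight vector `v` and the unipotent
translates of `weyl v`. -/
theorem eq_top_of_mem_of_upper_weyl_mem (hρ : ρ.IsIrreducible) (hv : v ∈ weightSpace ρ ψ 0)
    (hv0 : v ≠ 0) (hχ : ∀ r, ρ (torus r) v = χ r • v) {W : Submodule ℂ V} (h1 : v ∈ W)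
    (h2 : ∀ x, ρ (upper x) (ρ weyl v) ∈ W) : W = ⊤ := by
  refine hρ.eq_top_of_forall_mem hv0 fun g => ?_
  by_cases h : g 1 0 = 0
  · obtain ⟨r, x, rfl, -⟩ := exists_eq_torus_mul_upper h
    rw [map_mul, Module.End.mul_apply, mem_weightSpace_zero.1 hv, hχ]
    exact W.smul_mem _ h1
  · obtain ⟨x, r, y, rfl⟩ := exists_eq_upper_mul_torus_mul_weyl_mul_upper h
    rw [map_mul, Module.End.mul_apply, mem_weightSpace_zero.1 hv, torus_mul_weyl, map_mul, map_mul,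
      Module.End.mul_apply, Module.End.mul_apply, hχ, map_smul, map_smul]
    exact W.smul_mem _ (h2 x)

variable [Fintype F]

theorem weightProj_upper (a x : F) (z : V) :
    weightProj ρ ψ a (ρ (upper x) z) = ψ (a * x) • weightProj ρ ψ a z := by
  rw [← Module.End.mul_apply, weightProj_mul_upper, LinearMap.smul_apply]

theorem torus_weightProj_zero_weyl (hχ : ∀ r, ρ (torus r) v = χ r • v) (r : Fˣ) :
    ρ (torus r) (weightProj ρ ψ 0 (ρ weyl v)) =
      χ r⁻¹ • weightProj ρ ψ 0 (ρ weyl v) := by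
  rw [← Module.End.mul_apply, torus_mul_weightProj_zero, Module.End.mul_apply, map_torus_map_weyl,
    hχ, map_smul, map_smul]

theorem weightSpace_zero_le_span (hρ : ρ.IsIrreducible)
    (hv : v ∈ weightSpace ρ ψ 0) (hv0 : v ≠ 0) (hχ : ∀ r, ρ (torus r) v = χ r • v) :
    weightSpace ρ ψ 0 ≤ Submodule.span ℂ {v, weightProj ρ ψ 0 (ρ weyl v)} := by
  have key := eq_top_of_mem_of_upper_weyl_mem hρ hv hv0 hχ
    (W := (Submodule.span ℂ {v, weightProj ρ ψ 0 (ρ weyl v)}).comap (weightProj ρ ψ 0))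
    (by
      rw [Submodule.mem_comap, weightProj_apply_of_mem ρ ψ hv]
      exact Submodule.subset_span (by simp))
    (fun x => by
      rw [Submodule.mem_comap, weightProj_upper]
      simpa using Submodule.subset_span (by simp))
  intro z hz
  have hz' : z ∈ (Submodule.span ℂ {v, weightProj ρ ψ 0 (ρ weyl v)}).comap (weightProj ρ ψ 0) :=
    key ▸ Submodule.mem_top
  rwa [Submodule.mem_comap, weightProj_apply_of_mem ρ ψ hz] at hz'

variable [DecidableEq F]

theorem weightProj_zero_weyl_weightProj_weyl (hneg : ρ (-1) = 1) (hv : v ∈ weightSpace ρ ψ 0)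
    (hχ : ∀ r, ρ (torus r) v = χ r • v) (a : F) :
    weightProj ρ ψ 0 (ρ weyl (weightProj ρ ψ a (ρ weyl v))) = (Fintype.card F : ℂ)⁻¹ •
      (v + (∑ x : Fˣ, ψ (-(a * x)) * χ x) • weightProj ρ ψ 0 (ρ weyl v)) := by
  rw [weightProj_apply ρ ψ a, map_smul, map_smul, map_sum, map_sum, sum_eq_add_sum_units]
  congr 2
  · simp [map_weyl_map_weyl hneg, weightProj_apply_of_mem ρ ψ hv]
  · rw [Finset.sum_smul]
    refine Finset.sum_congr rfl fun x _ => ?_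
    rw [map_smul, map_smul, map_weyl_upper_weyl hneg hv, hχ, weightProj_upper]
    simp [smul_smul]

theorem weightProj_zero_weyl_ne_zero (hneg : ρ (-1) = 1) (hv : v ∈ weightSpace ρ ψ 0)
    (hv0 : v ≠ 0) (hχ : ∀ r, ρ (torus r) v = χ r • v) :
    weightProj ρ ψ 0 (ρ weyl v) ≠ 0 := fun h => by
  have := weightProj_zero_weyl_weightProj_weyl hneg hv hχ 0
  rw [h] at this
  simp [eq_comm (a := (0 : V)), hv0] at this

theorem add_smul_eq_zero_of_weightSpace_eq_bot (hneg : ρ (-1) = 1) (hv : v ∈ weightSpace ρ ψ 0)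
    (hχ : ∀ r, ρ (torus r) v = χ r • v) {a : F} (ha : weightSpace ρ ψ a = ⊥) :
    v + (∑ x : Fˣ, ψ (-(a * x)) * χ x) • weightProj ρ ψ 0 (ρ weyl v) = 0 := by
  have h := weightProj_zero_weyl_weightProj_weyl hneg hv hχ a
  have h0 : weightProj ρ ψ a (ρ weyl v) = 0 := by
    have := weightProj_mem ρ ψ a (ρ weyl v)
    rwa [ha, Submodule.mem_bot] at this
  rw [h0, map_zero, map_zero, eq_comm, smul_eq_zero] at h
  exact h.resolve_left (by simp)

variable [FiniteDimensional ℂ V]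

omit [DecidableEq F] in
theorem exists_torus_eigenvector (h : weightSpace ρ ψ 0 ≠ ⊥) :
    ∃ v ∈ weightSpace ρ ψ 0, v ≠ 0 ∧ ∃ χ : Fˣ → ℂ, ∀ r, ρ (torus r) v = χ r • v := by
  obtain ⟨v, hv, hv0⟩ := Submodule.exists_mem_ne_zero_of_ne_bot h
  obtain ⟨γ, hγ⟩ := IsCyclic.exists_generator (α := Fˣ)
  have : Nontrivial (weightSpace ρ ψ 0) := ⟨⟨v, hv⟩, 0, fun h => hv0 (congrArg Subtype.val h)⟩
  obtain ⟨μ, hμ⟩ := End.exists_eigenvalue ((ρ (torus γ)).restrict (p := weightSpace ρ ψ 0)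
      (q := weightSpace ρ ψ 0) fun v hv => torus_mem_weightSpace ρ ψ γ (by rwa [zero_mul]))
  obtain ⟨⟨w, hw⟩, hw2⟩ := hμ.exists_hasEigenvector
  have hw0 : w ≠ 0 := fun h => hw2.2 (Subtype.ext h)
  have hμw : ρ (torus γ) w = μ • w := congrArg Subtype.val hw2.apply_eq_smul
  refine ⟨w, hw, hw0, ?_⟩
  suffices ∀ r, ∃ c : ℂ, ρ (torus r) w = c • w from ⟨_, fun r => (this r).choose_spec⟩
  intro r
  obtain ⟨n, rfl⟩ := (mem_powers_iff_mem_zpowers.2 (hγ r))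
  refine ⟨μ ^ n, ?_⟩
  simp only
  induction n with
  | zero => simp
  | succ n ih => rw [pow_succ', torus_mul, map_mul, Module.End.mul_apply, ih, map_smul, hμw,
      smul_smul, pow_succ]

theorem finrank_weightSpace_zero_eq_one (hρ : ρ.IsIrreducible)
    (hneg : ρ (-1) = 1) (h0 : weightSpace ρ ψ 0 ≠ ⊥) {a : F} (ha : weightSpace ρ ψ a = ⊥) :
    finrank ℂ (weightSpace ρ ψ 0) = 1 := by
  obtain ⟨v, hv, hv0, χ, hχ⟩ := exists_torus_eigenvector h0
  have h := add_smul_eq_zero_of_weightSpace_eq_bot hneg hv hχ ha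
  have hle := weightSpace_zero_le_span hρ hv hv0 hχ
  rw [Submodule.span_insert_eq_span] at hle
  · exact le_antisymm ((Submodule.finrank_mono hle).trans (finrank_span_singleton
      (weightProj_zero_weyl_ne_zero hneg hv hv0 hχ)).le)
      (Submodule.one_le_finrank_iff.2 h0)
  · refine Set.mem_of_eq_of_mem (eq_neg_of_add_eq_zero_left h) ?_
    exact Submodule.neg_mem _ (Submodule.smul_mem _ _ (Submodule.mem_span_singleton_self _))

theorem weightSpace_of_borelFixed_ne_bot (hψ : ψ.IsPrimitive) (hρ : ρ.IsIrreducible)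
    (hneg : ρ (-1) = 1) (hnt : ∃ g, ρ g ≠ 1) (hB : borelFixed ρ ψ ≠ ⊥) :
    finrank ℂ (borelFixed ρ ψ) = 1 ∧ ∀ a, finrank ℂ (weightSpace ρ ψ a) = 1 := by
  obtain ⟨v, ⟨hvT, hv⟩, hv0⟩ := Submodule.exists_mem_ne_zero_of_ne_bot hB
  have hχ : ∀ r, ρ (torus r) v = (fun _ => (1 : ℂ)) r • v := fun r => by
    rw [one_smul]; exact hvT r
  set A := weightProj ρ ψ 0 (ρ weyl v) with hA
  have hqA : (Fintype.card F : ℂ) • A = ∑ x, ρ (upper x) (ρ weyl v) := by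
    rw [hA, weightProj_apply, smul_smul, mul_inv_cancel₀ (by simp), one_smul]
    simp
  have hS : v + (Fintype.card F : ℂ) • A = 0 := by
    by_contra hne
    have hSx : v + (Fintype.card F : ℂ) • A =
        v + ρ weyl v + ∑ x : Fˣ, ρ (upper (x : F)) (ρ weyl v) := by
      rw [hqA, sum_eq_add_sum_units, upper_zero, map_one, Module.End.one_apply, add_assoc]
    have hfix (g) : ρ g (v + (Fintype.card F : ℂ) • A) = v + (Fintype.card F : ℂ) • A := by
      let H : Subgroup (SpecialLinearGroup (Fin 2) F) :=
        { carrier := {g | ρ g (v + (Fintype.card F : ℂ) • A) = v + (Fintype.card F : ℂ) • A}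
          mul_mem' := fun {g h} hg hh => by
            rw [Set.mem_ofPred_eq] at hg hh ⊢
            rw [map_mul, Module.End.mul_apply, hh, hg]
          one_mem' := by simp
          inv_mem' := fun {g} hg => by
            rw [Set.mem_ofPred_eq] at hg ⊢
            nth_rw 1 [← hg]
            simp }
      have hH : H = ⊤ := by
        refine eq_top_of_upper_of_weyl (fun x => ?_) ?_
        · have h0 : v + (Fintype.card F : ℂ) • A ∈ weightSpace ρ ψ 0 :=
            Submodule.add_mem _ hv (Submodule.smul_mem _ _ (weightProj_mem ρ ψ 0 _))
          exact mem_weightSpace_zero.1 h0 x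
        · change ρ weyl _ = _
          rw [hSx, map_add, map_add, map_weyl_map_weyl hneg, map_sum, add_comm v]
          congr 1
          refine Fintype.sum_equiv ((Equiv.inv Fˣ).trans (Equiv.neg Fˣ)) _ _ fun x => ?_
          rw [map_weyl_upper_weyl hneg hv, hvT]
          simp
      exact (hH ▸ Subgroup.mem_top g : g ∈ H)
    have htop := hρ.eq_top_of_forall_mem hne
      (W := Submodule.span ℂ {v + (Fintype.card F : ℂ) • A}) fun g => by
        rw [hfix]; exact Submodule.mem_span_singleton_self _
    obtain ⟨g, hg⟩ := hnt
    refine hg (LinearMap.ext fun z => ?_)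
    obtain ⟨c, rfl⟩ := Submodule.mem_span_singleton.1
      (htop ▸ Submodule.mem_top : z ∈ Submodule.span ℂ {v + (Fintype.card F : ℂ) • A})
    rw [map_smul, hfix, Module.End.one_apply]
  have hspan : weightSpace ρ ψ 0 ≤ Submodule.span ℂ {v} := by
    have hle := weightSpace_zero_le_span hρ hv hv0 hχ
    rwa [Set.pair_comm, Submodule.span_insert_eq_span] at hle
    rw [← hA, Submodule.mem_span_singleton]
    refine ⟨-(Fintype.card F : ℂ)⁻¹, ?_⟩
    rw [eq_neg_of_add_eq_zero_left hS]
    simp [smul_smul]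
  have h1 : finrank ℂ (weightSpace ρ ψ 0) = 1 :=
    le_antisymm ((Submodule.finrank_mono hspan).trans (finrank_span_singleton hv0).le)
      (Submodule.one_le_finrank_iff.2 fun h => hv0 ((Submodule.mem_bot ℂ).1 (h ▸ hv)))
  refine ⟨le_antisymm ?_ (Submodule.one_le_finrank_iff.2 hB), fun a => ?_⟩
  · exact (Submodule.finrank_mono inf_le_right).trans h1.le
  by_cases ha : a = 0
  · rw [ha, h1]
  refine le_antisymm (finrank_weightSpace_le_one ρ hρ hψ ha)
    (Submodule.one_le_finrank_iff.2 fun hbot => ?_)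
  have h2 := add_smul_eq_zero_of_weightSpace_eq_bot hneg hv hχ hbot
  have h3 : ∑ x : Fˣ, ψ (-(a * x)) * 1 = -1 := by
    have := AddChar.sum_mulShift (-a) hψ
    rw [if_neg (by simpa using ha), sum_eq_add_sum_units, zero_mul, AddChar.map_zero_eq_one,
      Nat.cast_zero] at this
    rw [← eq_neg_of_add_eq_zero_right this]
    simp [mul_comm]
  rw [h3, neg_one_smul, ← sub_eq_add_neg, sub_eq_zero, ← hA] at h2
  rw [← h2, ← one_smul ℂ v, smul_smul, ← add_smul, smul_eq_zero] at hS
  refine hS.elim (fun h => ?_) hv0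
  rw [mul_one, ← Nat.cast_one, ← Nat.cast_add, Nat.cast_eq_zero] at h
  omega

theorem borelFixed_ne_bot_of_finrank_weightSpace_zero_eq_one
    (hneg : ρ (-1) = 1) (h1 : finrank ℂ (weightSpace ρ ψ 0) = 1)
    (hsq : ∀ r : Fˣ, ∃ s : Fˣ, ρ (torus r) = ρ (torus (s * s))) : borelFixed ρ ψ ≠ ⊥ := by
  obtain ⟨v, hv, hv0, χ, hχ⟩ := exists_torus_eigenvector (ρ := ρ) (ψ := ψ) fun h => by
    rw [h, finrank_bot] at h1; exact zero_ne_one h1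
  have hA0 := weightProj_zero_weyl_ne_zero hneg hv hv0 hχ
  have hχinv (r : Fˣ) : χ r⁻¹ = χ r := by
    obtain ⟨c, hc⟩ := (finrank_eq_one_iff_of_nonzero' (⟨v, hv⟩ : weightSpace ρ ψ 0)
      fun h => hv0 (congrArg Subtype.val h)).1 h1 ⟨_, weightProj_mem ρ ψ 0 (ρ weyl v)⟩
    have hc : c • v = weightProj ρ ψ 0 (ρ weyl v) := congrArg Subtype.val hc
    have h := torus_weightProj_zero_weyl (ψ := ψ) hχ r
    rw [← hc, map_smul, hχ, smul_comm, hc] at h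
    exact (smul_left_injective ℂ hA0 h).symm
  refine Submodule.ne_bot_iff _ |>.2 ⟨v, ⟨fun r => ?_, hv⟩, hv0⟩
  obtain ⟨s, hs⟩ := hsq r
  have h1 : ρ (torus (s⁻¹ * s)) v = v := by simp
  rw [torus_mul, map_mul, Module.End.mul_apply, hχ, map_smul, hχ, hχinv] at h1
  rw [hs, torus_mul, map_mul, Module.End.mul_apply, hχ, map_smul, hχ, h1]

end principal

section conjugacy

variable {F : Type} [Field F]

/-- The polynomial `X² - t X + 1` has no root in `F`. -/
def IsNonsplit (t : F) : Prop := ∀ r : F, r ^ 2 - t * r + 1 ≠ 0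

theorem IsNonsplit.one_zero_ne_zero {x : SpecialLinearGroup (Fin 2) F}
    (h : IsNonsplit (x 0 0 + x 1 1)) : x 1 0 ≠ 0 := fun h0 => by
  refine h (x 0 0) ?_
  have := det_eq x
  rw [h0] at this
  linear_combination -this

theorem IsNonsplit.ne_zero_of_two_eq_zero {t : F} (h : IsNonsplit t) (h2 : (2 : F) = 0) :
    t ≠ 0 := fun h0 => h 1 (by rw [h0]; linear_combination h2)

theorem IsNonsplit.sq_ne_four {t : F} (h : IsNonsplit t) (h2 : (2 : F) ≠ 0) : t ^ 2 - 4 ≠ 0 :=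
  fun h0 => h (t / 2) (by field_simp; linear_combination -h0)

theorem trace_conj (g x : SpecialLinearGroup (Fin 2) F) :
    (g⁻¹ * x * g) 0 0 + (g⁻¹ * x * g) 1 1 = x 0 0 + x 1 1 := by
  simp only [mul_apply', inv_apply_zero_zero, inv_apply_zero_one, inv_apply_one_zero,
    inv_apply_one_one]
  linear_combination (x 0 0 + x 1 1) * det_eq g

theorem conj_apply_one_zero (g x : SpecialLinearGroup (Fin 2) F) : (g⁻¹ * x * g) 1 0 =
    x 1 0 * g 0 0 ^ 2 + (x 1 1 - x 0 0) * g 0 0 * g 1 0 - x 0 1 * g 1 0 ^ 2 := by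
  simp only [mul_apply', inv_apply_one_zero, inv_apply_one_one]
  ring

theorem conj_apply_zero_one (g x : SpecialLinearGroup (Fin 2) F) : (g⁻¹ * x * g) 0 1 =
    -x 1 0 * g 0 1 ^ 2 - (x 1 1 - x 0 0) * g 0 1 * g 1 1 + x 0 1 * g 1 1 ^ 2 := by
  simp only [mul_apply', inv_apply_zero_zero, inv_apply_zero_one]
  ring

theorem exists_column {a c : F} (h : a ≠ 0 ∨ c ≠ 0) :
    ∃ g : SpecialLinearGroup (Fin 2) F, g 0 0 = a ∧ g 1 0 = c := by
  by_cases ha : a = 0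
  · exact ⟨ofEntries a (-c⁻¹) c 0 (by simp [h.resolve_left (not_not.2 ha)]), rfl, rfl⟩
  · exact ⟨ofEntries a 0 c a⁻¹ (by simp [ha]), rfl, rfl⟩

theorem exists_conj_apply_one_zero_eq_zero {x : SpecialLinearGroup (Fin 2) F}
    (h : ¬ IsNonsplit (x 0 0 + x 1 1)) : ∃ g, (g⁻¹ * x * g) 1 0 = 0 := by
  simp only [IsNonsplit, not_forall, not_not] at h
  obtain ⟨r, hr⟩ := h
  have hd := det_eq x
  by_cases hc : x 1 0 = 0
  · exact ⟨1, by simpa using hc⟩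
  · obtain ⟨g, h0, h1⟩ := exists_column (F := F) (a := r - x 1 1) (Or.inr hc)
    refine ⟨g, ?_⟩
    rw [conj_apply_one_zero, h0, h1]
    linear_combination x 1 0 * hr + x 1 0 * hd

/-- Up to conjugacy and sign, an element of `SL₂` is diagonal, unipotent or nonsplit. -/
theorem exists_conj (x : SpecialLinearGroup (Fin 2) F) :
    IsNonsplit (x 0 0 + x 1 1) ∨
      (∃ g, ∃ r : Fˣ, (r : F) ^ 2 ≠ 1 ∧ g⁻¹ * x * g = torus r) ∨
      ∃ g z, g⁻¹ * x * g = upper z ∨ g⁻¹ * x * g = -upper z := by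
  by_cases h : IsNonsplit (x 0 0 + x 1 1)
  · exact Or.inl h
  obtain ⟨g, hg⟩ := exists_conj_apply_one_zero_eq_zero h
  obtain ⟨r, z, hrz, -⟩ := exists_eq_torus_mul_upper hg
  refine Or.inr ?_
  by_cases hr : (r : F) ^ 2 = 1
  · refine Or.inr ⟨g, z, ?_⟩
    rw [hrz]
    rcases sq_eq_one_iff.1 hr with h | h
    · rw [show r = 1 from Units.ext h]; simp
    · rw [show r = -1 from Units.ext h, torus_neg_one]; simp
  · have hr' : (r : F) ^ 2 - 1 ≠ 0 := sub_ne_zero.2 hr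
    refine Or.inl ⟨g * upper (-((r : F) ^ 2 * z / (r ^ 2 - 1))), r, hr, ?_⟩
    have : (g * upper (-((r : F) ^ 2 * z / (r ^ 2 - 1))))⁻¹ * x *
        (g * upper (-((r : F) ^ 2 * z / (r ^ 2 - 1)))) =
        upper ((r : F) ^ 2 * z / (r ^ 2 - 1)) * (g⁻¹ * x * g) *
          upper (-((r : F) ^ 2 * z / (r ^ 2 - 1))) := by
      rw [upper_neg]; group
    rw [this, hrz]
    simp [ext_iff_entries, torus, upper]
    field_simp
    ring

variable [Finite F]

theorem exists_sq_sub_mul_sq (h2 : (2 : F) ≠ 0) {D : F} (hD : D ≠ 0) (c : F) :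
    ∃ X Y : F, X ^ 2 - D * Y ^ 2 = c := by
  have := Fintype.ofFinite F
  have hodd : Fintype.card F % 2 = 1 := FiniteField.odd_card_of_char_ne_two fun h =>
    h2 (by have := ringChar.Nat.cast_ringChar (R := F); rw [h] at this; exact_mod_cast this)
  obtain ⟨X, Y, h⟩ := FiniteField.exists_root_sum_quadratic
    (f := Polynomial.C 1 * Polynomial.X ^ 2 + Polynomial.C 0 * Polynomial.X + Polynomial.C (-c))
    (g := Polynomial.C (-D) * Polynomial.X ^ 2 + Polynomial.C 0 * Polynomial.X + Polynomial.C 0)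
    (Polynomial.degree_quadratic one_ne_zero)
    (Polynomial.degree_quadratic (neg_ne_zero.2 hD)) hodd
  refine ⟨X, Y, ?_⟩
  simp at h
  linear_combination h

theorem IsNonsplit.exists_companion_conj {y : SpecialLinearGroup (Fin 2) F}
    (h : IsNonsplit (y 0 0 + y 1 1)) :
    ∃ g, g⁻¹ * y * g = ofEntries 0 (-1) 1 (y 0 0 + y 1 1) (by simp) := by
  have hc := h.one_zero_ne_zero
  have hd := det_eq y
  obtain ⟨u, v, huv⟩ : ∃ u v : F,
      y 1 0 * u ^ 2 + (y 1 1 - y 0 0) * u * v - y 0 1 * v ^ 2 = 1 := by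
    by_cases h2 : (2 : F) = 0
    · have hsq : IsSquare (y 1 0) := FiniteField.isSquare_of_char_two
        (neg_one_eq_one_iff.1 (by linear_combination -h2)) _
      obtain ⟨u, hu⟩ := hsq
      have hu0 : u ≠ 0 := fun h => hc (by rw [hu, h, mul_zero])
      exact ⟨u⁻¹, 0, by rw [hu]; field_simp; ring⟩
    · obtain ⟨X, Y, hXY⟩ := exists_sq_sub_mul_sq h2 (h.sq_ne_four h2) (y 1 0)
      refine ⟨(X - (y 1 1 - y 0 0) * Y) / y 1 0, 2 * Y, ?_⟩
      field_simp
      linear_combination hXY + 4 * Y ^ 2 * hd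
  refine ⟨ofEntries u (y 0 0 * u + y 0 1 * v) v (y 1 0 * u + y 1 1 * v)
    (by linear_combination huv), ?_⟩
  refine (mul_assoc _ _ _).trans (inv_mul_eq_iff_eq_mul.2 ?_)
  simp only [ext_iff_entries, mul_apply', ofEntries_apply]
  simp
  constructor
  · linear_combination -u * hd
  · linear_combination -v * hd

/-- Nonsplit elements of `SL₂` with the same trace are conjugate. -/
theorem IsNonsplit.exists_conj_eq {y y' : SpecialLinearGroup (Fin 2) F}
    (h : IsNonsplit (y 0 0 + y 1 1)) (htr : y 0 0 + y 1 1 = y' 0 0 + y' 1 1) :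
    ∃ g, g⁻¹ * y * g = y' := by
  obtain ⟨g, hg⟩ := h.exists_companion_conj
  obtain ⟨g', hg'⟩ := (htr ▸ h).exists_companion_conj (y := y')
  simp only [← htr] at hg'
  refine ⟨g * g'⁻¹, ?_⟩
  rw [← hg] at hg'
  rw [show y' = g' * (g'⁻¹ * y' * g') * g'⁻¹ by group, hg']
  group

end conjugacy

section counting

variable {F : Type} [Field F]

/-- Elements of trace `t` commuting with `x`. -/
def traceCommuting (t : F) (x : SpecialLinearGroup (Fin 2) F) :
    Set (SpecialLinearGroup (Fin 2) F) := {y | y 0 0 + y 1 1 = t ∧ Commute y x}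

/-- Elements conjugating `x` into the upper triangular subgroup. -/
def toBorel (x : SpecialLinearGroup (Fin 2) F) : Set (SpecialLinearGroup (Fin 2) F) :=
  {g | (g⁻¹ * x * g) 1 0 = 0}

/-- Elements conjugating `x` into the diagonal subgroup. -/
def toTorus (x : SpecialLinearGroup (Fin 2) F) : Set (SpecialLinearGroup (Fin 2) F) :=
  {g | (g⁻¹ * x * g) 1 0 = 0 ∧ (g⁻¹ * x * g) 0 1 = 0}

theorem card_traceCommuting_conj (t : F) (h x : SpecialLinearGroup (Fin 2) F) :
    Nat.card (traceCommuting t (h⁻¹ * x * h)) = Nat.card (traceCommuting t x) := by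
  refine (Nat.card_congr (Equiv.subtypeEquiv (MulAut.conj h⁻¹).toEquiv fun y => ?_)).symm
  have h1 := trace_conj h y
  have h2 := Commute.conj_iff (a := y) (b := x) h⁻¹
  have h3 : (MulAut.conj h⁻¹).toEquiv y = h⁻¹ * y * h := by simp
  rw [inv_inv] at h2
  rw [h3]
  exact and_congr (by rw [h1]) h2.symm

theorem card_toBorel_conj (h x : SpecialLinearGroup (Fin 2) F) :
    Nat.card (toBorel (h⁻¹ * x * h)) = Nat.card (toBorel x) := by
  refine Nat.card_congr (Equiv.subtypeEquiv (Equiv.mulLeft h) fun y => ?_)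
  simp only [toBorel, Set.mem_ofPred_eq, Equiv.coe_mulLeft]
  rw [show (h * y)⁻¹ * x * (h * y) = y⁻¹ * (h⁻¹ * x * h) * y by group]

theorem card_toTorus_conj (h x : SpecialLinearGroup (Fin 2) F) :
    Nat.card (toTorus (h⁻¹ * x * h)) = Nat.card (toTorus x) := by
  refine Nat.card_congr (Equiv.subtypeEquiv (Equiv.mulLeft h) fun y => ?_)
  simp only [toTorus, Set.mem_ofPred_eq, Equiv.coe_mulLeft]
  rw [show (h * y)⁻¹ * x * (h * y) = y⁻¹ * (h⁻¹ * x * h) * y by group]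

theorem traceCommuting_neg (t : F) (x : SpecialLinearGroup (Fin 2) F) :
    traceCommuting t (-x) = traceCommuting t x := by
  ext y
  refine and_congr_right fun _ => ?_
  rw [Commute, SemiconjBy, Commute, SemiconjBy, mul_neg, neg_mul, neg_inj]

theorem toBorel_neg (x : SpecialLinearGroup (Fin 2) F) : toBorel (-x) = toBorel x := by
  ext y
  simp only [toBorel, Set.mem_ofPred_eq, mul_neg, neg_mul, neg_apply', neg_eq_zero]

theorem toTorus_neg (x : SpecialLinearGroup (Fin 2) F) : toTorus (-x) = toTorus x := by
  ext y
  simp only [toTorus, Set.mem_ofPred_eq, mul_neg, neg_mul, neg_apply', neg_eq_zero]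

/-- Elements of nonsplit trace are determined by their first column. -/
def IsNonsplit.traceEquiv {t : F} (ht : IsNonsplit t) :
    {y : SpecialLinearGroup (Fin 2) F // y 0 0 + y 1 1 = t} ≃ F × Fˣ where
  toFun y := (y.1 0 0, Units.mk0 (y.1 1 0) (IsNonsplit.one_zero_ne_zero (by rwa [y.2])))
  invFun p := ⟨ofEntries p.1 ((p.1 * (t - p.1) - 1) / p.2) p.2 (t - p.1) (by field_simp; ring),
    by simp⟩
  left_inv y := by
    obtain ⟨y, rfl⟩ := y
    have hy : y 1 0 ≠ 0 := IsNonsplit.one_zero_ne_zero ht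
    ext1
    simp only [ext_iff_entries, ofEntries_apply]
    simp
    field_simp
    linear_combination det_eq y
  right_inv p := by
    ext <;> simp

/-- Upper triangular matrices of determinant one. -/
def borelEquiv : {g : SpecialLinearGroup (Fin 2) F // g 1 0 = 0} ≃ F × Fˣ where
  toFun g := (g.1 0 1, ⟨g.1 0 0, g.1 1 1, by have := det_eq g.1; rw [g.2] at this; simpa using this,
    by have := det_eq g.1; rw [g.2] at this; linear_combination this⟩)
  invFun p := ⟨ofEntries p.2 p.1 0 ↑(p.2⁻¹) (by simp), rfl⟩
  left_inv g := by
    ext1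
    simp only [ext_iff_entries, ofEntries_apply]
    simp [g.2]
  right_inv p := by ext <;> simp

/-- The open Bruhat cell. -/
def bigCellEquiv : {g : SpecialLinearGroup (Fin 2) F // ¬ g 1 0 = 0} ≃ F × F × Fˣ where
  toFun g := (g.1 0 0, g.1 1 1, Units.mk0 (g.1 1 0) g.2)
  invFun p := ⟨ofEntries p.1 ((p.1 * p.2.1 - 1) / p.2.2) p.2.2 p.2.1 (by field_simp; ring),
    p.2.2.ne_zero⟩
  left_inv g := by
    have hg := g.2
    ext1
    simp only [ext_iff_entries, ofEntries_apply]
    simp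
    field_simp
    linear_combination det_eq g.1
  right_inv p := by ext <;> simp

/-- Diagonal matrices of determinant one. -/
def torusEquiv : {g : SpecialLinearGroup (Fin 2) F // g 1 0 = 0 ∧ g 0 1 = 0} ≃ Fˣ where
  toFun g := ⟨g.1 0 0, g.1 1 1, by have := det_eq g.1; rw [g.2.1] at this; simpa using this,
    by have := det_eq g.1; rw [g.2.1] at this; linear_combination this⟩
  invFun p := ⟨torus p, rfl, rfl⟩
  left_inv g := by
    ext1
    simp only [ext_iff_entries, torus, ofEntries_apply]
    have := det_eq g.1
    rw [g.2.1] at this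
    simp [g.2.1, g.2.2]
    exact inv_eq_of_mul_eq_one_right (by simpa using this)
  right_inv p := by ext; rfl

variable [Fintype F]

theorem card_special_linear_two : Nat.card (SpecialLinearGroup (Fin 2) F) =
    Nat.card F * Nat.card Fˣ * (Nat.card F + 1) := by
  classical
  rw [Nat.card_congr (Equiv.sumCompl (fun g : SpecialLinearGroup (Fin 2) F => g 1 0 = 0)).symm,
    Nat.card_sum, Nat.card_congr borelEquiv, Nat.card_congr bigCellEquiv]
  simp only [Nat.card_prod]
  ring

omit [Fintype F] in
theorem card_traceCommuting_one {t : F} (ht : IsNonsplit t) :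
    Nat.card (traceCommuting t 1) = Nat.card F * Nat.card Fˣ := by
  have : traceCommuting t 1 = {y | y 0 0 + y 1 1 = t} := by
    ext y; simp [traceCommuting]
  rw [this, ← Nat.card_prod]
  exact Nat.card_congr ht.traceEquiv

omit [Fintype F] in
theorem toBorel_one : toBorel (1 : SpecialLinearGroup (Fin 2) F) = Set.univ := by
  ext y; simp [toBorel, -mul_apply']

omit [Fintype F] in
theorem toTorus_one : toTorus (1 : SpecialLinearGroup (Fin 2) F) = Set.univ := by
  ext y; simp [toTorus, -mul_apply']

omit [Fintype F] in
theorem IsNonsplit.traceCommuting_eq_empty {t : F} (ht : IsNonsplit t)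
    {x : SpecialLinearGroup (Fin 2) F} (hx : x 1 0 = 0) (hx1 : x 0 1 ≠ 0 ∨ x 0 0 ≠ x 1 1) :
    traceCommuting t x = ∅ := by
  refine Set.eq_empty_of_forall_notMem fun y hy => ?_
  obtain ⟨rfl, hc⟩ := hy
  have h := ext_iff_entries.1 hc.eq
  simp only [mul_apply', hx] at h
  have hy := ht.one_zero_ne_zero
  rcases hx1 with h1 | h1
  · exact mul_ne_zero h1 hy (by linear_combination -h.1)
  · exact mul_ne_zero hy (sub_ne_zero.2 h1) (by linear_combination h.2.2.1)

omit [Fintype F] in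
theorem card_toBorel_upper {z : F} (hz : z ≠ 0) :
    Nat.card (toBorel (upper z)) = Nat.card F * Nat.card Fˣ := by
  have : toBorel (upper z) = {g | g 1 0 = 0} := by
    ext g
    simp only [toBorel, Set.mem_ofPred_eq, conj_apply_one_zero]
    simp [upper, hz]
  rw [this, ← Nat.card_prod]
  exact Nat.card_congr borelEquiv

omit [Fintype F] in
theorem toTorus_upper {z : F} (hz : z ≠ 0) : toTorus (upper z) = ∅ := by
  refine Set.eq_empty_of_forall_notMem fun g hg => ?_
  simp only [toTorus, Set.mem_ofPred_eq, conj_apply_one_zero, conj_apply_zero_one] at hg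
  simp [upper, hz] at hg
  have := det_eq g
  simp [hg.1, hg.2] at this

theorem card_toBorel_torus {r : Fˣ} (hr : (r : F) ^ 2 ≠ 1) :
    Nat.card (toBorel (torus r)) = 2 * (Nat.card F * Nat.card Fˣ) := by
  classical
  have hr' : (r : F)⁻¹ - r ≠ 0 := fun h => hr (by
    have := r.ne_zero
    field_simp at h
    linear_combination -h)
  have : toBorel (torus r) = {g | g 0 0 = 0} ∪ {g | g 1 0 = 0} := by
    ext g
    simp only [toBorel, Set.mem_ofPred_eq, conj_apply_one_zero, Set.mem_union]
    simp [torus, hr']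
  rw [this, Nat.card_coe_set_eq, Set.ncard_union_eq, ← Nat.card_coe_set_eq, ← Nat.card_coe_set_eq]
  · have h1 : Nat.card {g : SpecialLinearGroup (Fin 2) F | g 1 0 = 0} =
        Nat.card F * Nat.card Fˣ := (Nat.card_congr borelEquiv).trans (Nat.card_prod _ _)
    have h2 : Nat.card {g : SpecialLinearGroup (Fin 2) F | g 0 0 = 0} =
        Nat.card {g : SpecialLinearGroup (Fin 2) F | g 1 0 = 0} := by
      refine Nat.card_congr (Equiv.subtypeEquiv (Equiv.mulLeft weyl) fun y => ?_)
      simp [weyl]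
    rw [h2, h1]; ring
  · refine Set.disjoint_left.2 fun g h0 h1 => ?_
    have := det_eq g
    simp_all

theorem card_toTorus_torus {r : Fˣ} (hr : (r : F) ^ 2 ≠ 1) :
    Nat.card (toTorus (torus r)) = 2 * Nat.card Fˣ := by
  classical
  have hr' : (r : F)⁻¹ - r ≠ 0 := fun h => hr (by
    have := r.ne_zero
    field_simp at h
    linear_combination -h)
  have : toTorus (torus r) = {g | g 0 0 = 0 ∧ g 1 1 = 0} ∪ {g | g 1 0 = 0 ∧ g 0 1 = 0} := by
    ext g
    simp only [toTorus, Set.mem_ofPred_eq, conj_apply_one_zero, conj_apply_zero_one,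
      Set.mem_union]
    have := det_eq g
    simp [torus, hr']
    constructor
    · rintro ⟨h1 | h1, h2 | h2⟩ <;> simp_all
    · rintro (⟨h1, h2⟩ | ⟨h1, h2⟩) <;> simp_all
  rw [this, Nat.card_coe_set_eq, Set.ncard_union_eq, ← Nat.card_coe_set_eq, ← Nat.card_coe_set_eq]
  · have h1 : Nat.card {g : SpecialLinearGroup (Fin 2) F | g 1 0 = 0 ∧ g 0 1 = 0} =
        Nat.card Fˣ := Nat.card_congr torusEquiv
    have h2 : Nat.card {g : SpecialLinearGroup (Fin 2) F | g 0 0 = 0 ∧ g 1 1 = 0} =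
        Nat.card {g : SpecialLinearGroup (Fin 2) F | g 1 0 = 0 ∧ g 0 1 = 0} := by
      refine Nat.card_congr (Equiv.subtypeEquiv (Equiv.mulLeft weyl) fun y => ?_)
      simp [weyl]
    rw [h2, h1]; ring
  · refine Set.disjoint_left.2 fun g h0 h1 => ?_
    have := det_eq g
    simp_all

omit [Fintype F] in
theorem IsNonsplit.toBorel_eq_empty {x : SpecialLinearGroup (Fin 2) F}
    (hx : IsNonsplit (x 0 0 + x 1 1)) : toBorel x = ∅ := by
  refine Set.eq_empty_of_forall_notMem fun g hg => ?_
  refine IsNonsplit.one_zero_ne_zero (x := g⁻¹ * x * g) ?_ hg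
  rwa [trace_conj]

omit [Fintype F] in
/-- The centralizer algebra of a nonsplit element is a field. -/
theorem IsNonsplit.eq_zero_of_det_eq_zero {x : SpecialLinearGroup (Fin 2) F}
    (hx : IsNonsplit (x 0 0 + x 1 1)) {a b c d : F} (h0 : a * d - b * c = 0)
    (h1 : b * x 1 0 = x 0 1 * c) (h2 : (a - d) * x 1 0 = c * (x 0 0 - x 1 1)) :
    a = 0 ∧ b = 0 ∧ c = 0 ∧ d = 0 := by
  have hc := hx.one_zero_ne_zero
  have hd := det_eq x
  obtain ⟨β, rfl⟩ : ∃ β, c = β * x 1 0 := ⟨c / x 1 0, by field_simp⟩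
  obtain rfl : b = β * x 0 1 := mul_right_cancel₀ hc (by linear_combination h1)
  obtain ⟨α, rfl⟩ : ∃ α, a = α + β * x 0 0 := ⟨a - β * x 0 0, by ring⟩
  obtain rfl : d = α + β * x 1 1 := mul_right_cancel₀ hc (by linear_combination -h2)
  have key : α ^ 2 + α * β * (x 0 0 + x 1 1) + β ^ 2 = 0 := by
    linear_combination h0 - β ^ 2 * hd
  by_cases hβ : β = 0
  · subst hβ
    have : α = 0 := by simpa using key
    simp [this]
  · refine absurd ?_ (hx (-α / β))
    field_simp
    linear_combination key

omit [Fintype F] in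
theorem IsNonsplit.sub_mul_inv_ne {t : F} (h : IsNonsplit t) (h2 : (2 : F) = 0) (s : F) :
    s ^ 2 + s ≠ (t ^ 2)⁻¹ := fun hs => by
  have ht := h.ne_zero_of_two_eq_zero h2
  refine h (t * s) ?_
  have : s ^ 2 * t ^ 2 + s * t ^ 2 = 1 := by
    rw [← add_mul, hs]; field_simp
  linear_combination this + (1 - t ^ 2 * s) * h2

theorem exists_sq_add_self (h2 : (2 : F) = 0) {a b : F} (ha : ∀ s : F, s ^ 2 + s ≠ a)
    (hb : ∀ s : F, s ^ 2 + s ≠ b) : ∃ s : F, s ^ 2 + s = a + b := by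
  let f : F →+ F := { toFun := fun s => s ^ 2 + s, map_zero' := by simp,
                      map_add' := fun x y => by linear_combination x * y * h2 }
  have hk : Nat.card f.ker = 2 := by
    have : (f.ker : Set F) = {0, 1} := by
      ext s
      simp only [SetLike.mem_coe, AddMonoidHom.mem_ker, Set.mem_insert_iff,
        Set.mem_singleton_iff]
      change s ^ 2 + s = 0 ↔ _
      rw [show s ^ 2 + s = s * (s - 1) by linear_combination s * h2, mul_eq_zero, sub_eq_zero]
    change Nat.card (f.ker : Set F) = 2
    rw [this, Nat.card_coe_set_eq, Set.ncard_pair zero_ne_one]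
  have hi : f.range.index = 2 := by
    have e1 := f.range.card_mul_index
    have e2 := f.ker.card_mul_index
    rw [AddSubgroup.index_ker, hk, ← e1, mul_comm] at e2
    exact (mul_left_cancel₀ Nat.card_pos.ne' e2).symm
  have := (AddSubgroup.add_mem_iff_of_index_two hi (a := a) (b := b)).2
    ⟨fun h => absurd h fun ⟨s, hs⟩ => ha s hs, fun h => absurd h fun ⟨s, hs⟩ => hb s hs⟩
  exact this

theorem IsNonsplit.exists_mul_sq_eq {t τ : F} (ht : IsNonsplit t) (hτ : IsNonsplit τ)
    (h2 : (2 : F) ≠ 0) : ∃ β : F, β ^ 2 * (τ ^ 2 - 4) = t ^ 2 - 4 := by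
  classical
  have key : ∀ {u : F}, IsNonsplit u → quadraticChar F (u ^ 2 - 4) = -1 := fun {u} hu => by
    rw [quadraticChar_neg_one_iff_not_isSquare]
    rintro ⟨s, hs⟩
    refine hu ((u + s) / 2) ?_
    field_simp
    linear_combination -hs
  have h1 : IsSquare ((t ^ 2 - 4) * (τ ^ 2 - 4)) := by
    rw [← quadraticChar_one_iff_isSquare (mul_ne_zero (ht.sq_ne_four h2) (hτ.sq_ne_four h2)),
      map_mul, key ht, key hτ]
    norm_num
  obtain ⟨s, hs⟩ := h1
  have hτ0 := hτ.sq_ne_four h2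
  refine ⟨s / (τ ^ 2 - 4), ?_⟩
  field_simp
  linear_combination -hs

theorem IsNonsplit.exists_algebra_element {t τ : F} (ht : IsNonsplit t) (hτ : IsNonsplit τ) :
    ∃ α β : F, 2 * α + β * τ = t ∧ α ^ 2 + α * β * τ + β ^ 2 = 1 := by
  by_cases h2 : (2 : F) = 0
  · obtain ⟨s, hs⟩ := exists_sq_add_self h2 (ht.sub_mul_inv_ne h2) (hτ.sub_mul_inv_ne h2)
    have ht0 := ht.ne_zero_of_two_eq_zero h2
    have hτ0 := hτ.ne_zero_of_two_eq_zero h2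
    refine ⟨t * s, t / τ, ?_, ?_⟩
    · field_simp; linear_combination s * h2
    · field_simp
      field_simp at hs
      linear_combination hs + t ^ 2 * h2
  · obtain ⟨β, hβ⟩ := ht.exists_mul_sq_eq hτ h2
    refine ⟨(t - β * τ) / 2, β, by field_simp; ring, ?_⟩
    have h4 : (4 : F) ≠ 0 := by
      rw [show (4 : F) = 2 * 2 by norm_num]; exact mul_ne_zero h2 h2
    field_simp
    linear_combination -hβ

theorem IsNonsplit.card_traceCommuting {t : F} (ht : IsNonsplit t)
    {x : SpecialLinearGroup (Fin 2) F} (hx : IsNonsplit (x 0 0 + x 1 1)) :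
    Nat.card (traceCommuting t x) = 2 := by
  obtain ⟨α, β, h1, h2⟩ := ht.exists_algebra_element hx
  have hd := det_eq x
  obtain ⟨y, hy⟩ : ∃ y, y = ofEntries (α + β * x 0 0) (β * x 0 1) (β * x 1 0) (α + β * x 1 1)
    (by linear_combination h2 + β ^ 2 * hd) := ⟨_, rfl⟩
  have hyt : y 0 0 + y 1 1 = t := by
    rw [hy]; simp; linear_combination h1
  have hyx : Commute y x := by
    refine ext_iff_entries.2 ?_
    simp only [mul_apply']
    rw [hy]
    simp
    refine ⟨?_, ?_, ?_, ?_⟩ <;> ring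
  have hset : traceCommuting t x = {y, y⁻¹} := by
    ext z
    simp only [traceCommuting, Set.mem_ofPred_eq, Set.mem_insert_iff, Set.mem_singleton_iff]
    constructor
    · rintro ⟨hzt, hzx⟩
      have hz := ext_iff_entries.1 hzx.eq
      have hw := ext_iff_entries.1 hyx.eq
      simp only [mul_apply'] at hz hw
      have hc := hx.one_zero_ne_zero
      have e1 : y 0 1 * z 1 0 = y 1 0 * z 0 1 := mul_right_cancel₀ hc (by
        linear_combination z 1 0 * hw.1 - y 1 0 * hz.1)
      have e2 : (y 0 0 - y 1 1) * z 1 0 = y 1 0 * (z 0 0 - z 1 1) := mul_right_cancel₀ hc (by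
        linear_combination -z 1 0 * hw.2.2.1 + y 1 0 * hz.2.2.1)
      have e3 : (y 0 0 - y 1 1) * z 0 1 = y 0 1 * (z 0 0 - z 1 1) := mul_right_cancel₀ hc (by
        linear_combination (y 0 0 - y 1 1) * hz.1 + x 0 1 * e2 - (z 0 0 - z 1 1) * hw.1)
      have e4 : z 0 0 + z 1 1 = y 0 0 + y 1 1 := hzt.trans hyt.symm
      have hdz := det_eq z
      have hdy := det_eq y
      have hprod : ((z : Matrix (Fin 2) (Fin 2) F) - y) *
          (z - (y⁻¹ : SpecialLinearGroup (Fin 2) F)) = 0 := by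
        ext i j
        fin_cases i <;> fin_cases j <;>
          simp only [Matrix.mul_apply, Fin.sum_univ_two, Matrix.sub_apply, Fin.zero_eta,
            Fin.mk_one, inv_apply_zero_zero, inv_apply_zero_one, inv_apply_one_zero,
            inv_apply_one_one, Matrix.zero_apply]
        · linear_combination z 0 0 * e4 - hdz + hdy - e1
        · linear_combination z 0 1 * e4 - e3
        · linear_combination z 1 0 * e4 + e2
        · linear_combination z 1 1 * e4 - hdz + hdy + e1
      have hdet := congrArg Matrix.det hprod
      rw [Matrix.det_mul, Matrix.det_zero, mul_eq_zero, det_fin_two, det_fin_two] at hdet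
      simp only [Matrix.sub_apply, inv_apply_zero_zero, inv_apply_zero_one, inv_apply_one_zero,
        inv_apply_one_one] at hdet
      rcases hdet with h | h
      · have := hx.eq_zero_of_det_eq_zero h (by linear_combination hz.1 - hw.1)
          (by linear_combination -hz.2.2.1 + hw.2.2.1)
        exact Or.inl (ext_iff_entries.2 (by simpa only [sub_eq_zero] using this))
      · have := hx.eq_zero_of_det_eq_zero h (by linear_combination hz.1 + hw.1)
          (by linear_combination -hz.2.2.1 - hw.2.2.1)
        refine Or.inr (ext_iff_entries.2 ?_)
        simpa only [sub_eq_zero, inv_apply_zero_zero, inv_apply_zero_one, inv_apply_one_zero,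
          inv_apply_one_one] using this
    · rintro (rfl | rfl)
      · exact ⟨hyt, hyx⟩
      · exact ⟨by simp; rw [add_comm]; exact hyt, hyx.inv_left⟩
  have hne : y ≠ y⁻¹ := by
    intro h
    have h := ext_iff_entries.1 h
    have hc : y 1 0 ≠ 0 := IsNonsplit.one_zero_ne_zero (by rwa [hyt])
    simp at h
    have h2 : (2 : F) = 0 :=
      (mul_eq_zero.1 (show 2 * y 1 0 = 0 by linear_combination h.2.2.1)).resolve_right hc
    refine ht.ne_zero_of_two_eq_zero h2 ?_
    rw [← hyt]
    linear_combination h.1 + y 1 1 * h2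
  rw [hset, Nat.card_coe_set_eq, Set.ncard_pair hne]

/-- The permutation character of a nonsplit torus plus twice that of a Borel subgroup is that of a
split torus plus two. -/
theorem card_identity {t : F} (ht : IsNonsplit t) (x : SpecialLinearGroup (Fin 2) F) :
    Nat.card F * Nat.card Fˣ * Nat.card (traceCommuting t x) + 2 * Nat.card (toBorel x) =
      Nat.card F * Nat.card (toTorus x) + 2 * (Nat.card F * Nat.card Fˣ) := by
  classical
  have huni : ∀ z : F, Nat.card F * Nat.card Fˣ * Nat.card (traceCommuting t (upper z)) +
      2 * Nat.card (toBorel (upper z)) =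
      Nat.card F * Nat.card (toTorus (upper z)) + 2 * (Nat.card F * Nat.card Fˣ) := by
    intro z
    by_cases hz : z = 0
    · subst hz
      rw [upper_zero, card_traceCommuting_one ht, toBorel_one, toTorus_one, Nat.card_univ,
        card_special_linear_two]
      have h1 : Nat.card F = Nat.card Fˣ + 1 := by
        rw [Nat.card_units, Nat.sub_add_cancel Nat.card_pos]
      rw [h1]; ring
    · rw [ht.traceCommuting_eq_empty rfl (Or.inl hz), toTorus_upper hz, card_toBorel_upper hz]
      simp
  rcases exists_conj x with hx | ⟨g, r, hr, hg⟩ | ⟨g, z, hg | hg⟩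
  · have h1 := hx.toBorel_eq_empty
    have h2 : toTorus x = ∅ := Set.subset_eq_empty (fun g hg => hg.1) h1
    rw [ht.card_traceCommuting hx, h1, h2]
    simp; ring
  · rw [← card_traceCommuting_conj t g, ← card_toBorel_conj g, ← card_toTorus_conj g, hg,
      ht.traceCommuting_eq_empty rfl (Or.inr ?_), card_toBorel_torus hr, card_toTorus_torus hr]
    · simp; ring
    · simp only [torus, ofEntries_apply]
      simp
      intro h
      refine hr ?_
      nth_rewrite 1 [sq, h]
      simp
  · rw [← card_traceCommuting_conj t g, ← card_toBorel_conj g, ← card_toTorus_conj g, hg, huni]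
  · rw [← card_traceCommuting_conj t g, ← card_toBorel_conj g, ← card_toTorus_conj g, hg,
      traceCommuting_neg, toBorel_neg, toTorus_neg, huni]

end counting

section generic

variable {G : Type*} [Group G] [Fintype G] {V : Type*} [AddCommGroup V] [Module ℂ V]

theorem sum_mul_card_conj (χ : G → ℂ) (hχ : ∀ g x, χ (g⁻¹ * x * g) = χ x) (p : G → Prop)
    [DecidablePred p] :
    ∑ x, χ x * Nat.card {g : G | p (g⁻¹ * x * g)} = Nat.card G * ∑ x with p x, χ x := by
  have h1 (x : G) : χ x * Nat.card {g : G | p (g⁻¹ * x * g)} =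
      ∑ g, if p (g⁻¹ * x * g) then χ x else 0 := by
    rw [← Finset.sum_filter, Finset.sum_const, nsmul_eq_mul, mul_comm]
    congr 2
    exact Nat.subtype_card _ (by simp)
  simp_rw [h1]
  rw [Finset.sum_comm, Nat.card_eq_fintype_card, ← nsmul_eq_mul, ← Finset.card_univ,
    ← Finset.sum_const, Finset.sum_filter]
  refine Finset.sum_congr rfl fun g _ => ?_
  refine Fintype.sum_equiv (MulAut.conj g⁻¹).toEquiv _ _ fun x => ?_
  have : (MulAut.conj g⁻¹).toEquiv x = g⁻¹ * x * g := by simp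
  rw [this, hχ]

omit [Fintype G] in
theorem character_conj (ρ : Representation ℂ G V) (g x : G) :
    ρ.character (g⁻¹ * x * g) = ρ.character x := by
  have := ρ.char_conj x g⁻¹
  rwa [inv_inv] at this

open Classical in
theorem sum_character_commute [FiniteDimensional ℂ V] (ρ : Representation ℂ G V) (y : G) :
    ∑ x with Commute y x, ρ.character x = Nat.card (Subgroup.centralizer {y}) *
      finrank ℂ (Representation.invariants (ρ.comp (Subgroup.centralizer {y}).subtype)) := by
  rw [← Representation.card_inv_mul_sum_char_eq_finrank, mul_inv_cancel_left₀
    (Nat.cast_ne_zero.2 Nat.card_pos.ne')]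
  exact Finset.sum_subtype _ (fun x => by
    rw [Finset.mem_filter_univ, Subgroup.mem_centralizer_singleton_iff]
    exact eq_comm) _

theorem sum_character_eq_zero [FiniteDimensional ℂ V] {ρ : Representation ℂ G V}
    (hρ : ρ.IsIrreducible) (hnt : ∃ g, ρ g ≠ 1) : ∑ x, ρ.character x = 0 := by
  have h := ρ.card_inv_mul_sum_char_eq_finrank
  have hbot : ρ.invariants = ⊥ := by
    by_contra hne
    obtain ⟨v, hv, hv0⟩ := Submodule.exists_mem_ne_zero_of_ne_bot hne
    have := hρ.eq_top_of_forall_mem hv0 (W := ρ.invariants) fun g => (hv g).symm ▸ hv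
    obtain ⟨g, hg⟩ := hnt
    exact hg (LinearMap.ext fun w => (this ▸ Submodule.mem_top : w ∈ ρ.invariants) g)
  rw [hbot, finrank_bot, Nat.cast_zero, mul_eq_zero] at h
  exact h.resolve_left (inv_ne_zero (Nat.cast_ne_zero.2 Nat.card_pos.ne'))

end generic

section nonsplit

variable {F : Type} [Field F] [Fintype F] [DecidableEq F] {V : Type*} [AddCommGroup V] [Module ℂ V]
  [FiniteDimensional ℂ V]
  {ρ : Representation ℂ (SpecialLinearGroup (Fin 2) F) V} {ψ : AddChar F ℂ}

theorem sum_character_torus : ∑ x with x 1 0 = 0 ∧ x 0 1 = 0, ρ.character x =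
    Nat.card Fˣ * finrank ℂ (torusFixed ρ) := by
  rw [Nat.card_eq_fintype_card, ← sum_trace_torus]
  symm
  refine Finset.sum_bij (fun r _ => torus r) ?_ ?_ ?_ ?_
  · intro r _; simp [torus]
  · intro r _ s _ h; exact Units.ext (ext_iff_entries.1 h).1
  · intro x hx
    obtain ⟨h1, h2⟩ := (Finset.mem_filter.1 hx).2
    refine ⟨torusEquiv ⟨x, h1, h2⟩, Finset.mem_univ _, ?_⟩
    exact congrArg Subtype.val (torusEquiv.left_inv ⟨x, h1, h2⟩)
  · intro r _; rfl

theorem sum_character_borel : ∑ x with x 1 0 = 0, ρ.character x =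
    Nat.card F * Nat.card Fˣ * finrank ℂ (borelFixed ρ ψ) := by
  rw [Nat.card_eq_fintype_card, Nat.card_eq_fintype_card, ← sum_trace_borel,
    ← Fintype.sum_prod_type']
  symm
  refine Finset.sum_bij (fun p _ => torus p.1 * upper p.2) ?_ ?_ ?_ ?_
  · intro r _; simp [torus, upper]
  · rintro ⟨r, x⟩ _ ⟨s, y⟩ _ h
    have h := ext_iff_entries.1 h
    simp [torus, upper] at h
    obtain rfl : r = s := Units.ext h.1
    simpa using h.2.1
  · intro x hx
    obtain ⟨r, y, h, -⟩ := exists_eq_torus_mul_upper (Finset.mem_filter.1 hx).2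
    exact ⟨(r, y), Finset.mem_univ _, h.symm⟩
  · intro r _; rfl

omit [FiniteDimensional ℂ V] in
open Classical in
theorem sum_character_commute_conj (g y : SpecialLinearGroup (Fin 2) F) :
    ∑ x with Commute (g⁻¹ * y * g) x, ρ.character x = ∑ x with Commute y x, ρ.character x := by
  rw [Finset.sum_filter, Finset.sum_filter]
  symm
  refine Fintype.sum_equiv (MulAut.conj g⁻¹).toEquiv _ _ fun x => ?_
  have h1 : (MulAut.conj g⁻¹).toEquiv x = g⁻¹ * x * g := by simp
  have h2 := Commute.conj_iff (a := y) (b := x) g⁻¹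
  rw [inv_inv] at h2
  rw [h1, character_conj, if_congr h2 rfl rfl]

omit [FiniteDimensional ℂ V] in
open Classical in
theorem sum_character_mul_card_traceCommuting {y : SpecialLinearGroup (Fin 2) F}
    (hy : IsNonsplit (y 0 0 + y 1 1)) :
    ∑ x, ρ.character x * Nat.card (traceCommuting (y 0 0 + y 1 1) x) =
      Nat.card F * Nat.card Fˣ * ∑ x with Commute y x, ρ.character x := by
  have h1 (x) : ρ.character x * Nat.card (traceCommuting (y 0 0 + y 1 1) x) =
      ∑ z with z 0 0 + z 1 1 = y 0 0 + y 1 1, if Commute z x then ρ.character x else 0 := by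
    rw [← Finset.sum_filter, Finset.sum_const, nsmul_eq_mul, mul_comm, Finset.filter_filter]
    congr 2
    exact Nat.subtype_card _ (by simp [traceCommuting])
  simp_rw [h1]
  rw [Finset.sum_comm]
  simp_rw [← Finset.sum_filter]
  rw [Finset.sum_congr rfl (g := fun _ => ∑ x with Commute y x, ρ.character x), Finset.sum_const,
    nsmul_eq_mul, ← Nat.cast_mul, ← card_traceCommuting_one hy]
  · congr 2
    exact (Nat.subtype_card _ (by simp [traceCommuting])).symm
  · intro z hz
    obtain ⟨g, rfl⟩ := hy.exists_conj_eq (Finset.mem_filter.1 hz).2.symm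
    exact sum_character_commute_conj g y

/-- A nonsplit torus has a fixed vector unless the split torus has exactly twice as many fixed
vectors as the Borel subgroup. -/
theorem finrank_invariants_centralizer (hρ : ρ.IsIrreducible) (hnt : ∃ g, ρ g ≠ 1)
    {y : SpecialLinearGroup (Fin 2) F} (hy : IsNonsplit (y 0 0 + y 1 1)) :
    finrank ℂ (Representation.invariants (ρ.comp (Subgroup.centralizer {y}).subtype)) = 0 ↔
      finrank ℂ (torusFixed ρ) = 2 * finrank ℂ (borelFixed ρ ψ) := by
  classical
  have h1 := sum_character_mul_card_traceCommuting (ρ := ρ) hy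
  have hB := sum_mul_card_conj ρ.character (character_conj ρ) (fun x => x 1 0 = 0)
  have hT := sum_mul_card_conj ρ.character (character_conj ρ) (fun x => x 1 0 = 0 ∧ x 0 1 = 0)
  rw [sum_character_borel (ψ := ψ)] at hB
  rw [sum_character_torus] at hT
  rw [sum_character_commute] at h1
  have h0 := sum_character_eq_zero hρ hnt
  have hid := Finset.sum_congr rfl fun (x : SpecialLinearGroup (Fin 2) F)
    (_ : x ∈ Finset.univ) => congrArg (fun n : ℕ => ρ.character x * n) (card_identity hy x)
  simp only [Nat.cast_add, Nat.cast_mul, mul_add, Finset.sum_add_distrib] at hid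
  have e1 : ∀ (c : ℂ) (f : SpecialLinearGroup (Fin 2) F → ℂ),
      ∑ x, ρ.character x * (c * f x) = c * ∑ x, ρ.character x * f x := fun c f => by
    rw [Finset.mul_sum]; exact Finset.sum_congr rfl fun x _ => by ring
  rw [e1, e1, e1, ← Finset.sum_mul, h0, h1] at hid
  change _ + _ * ∑ x, ρ.character x * (Nat.card {g | (g⁻¹ * x * g) 1 0 = 0} : ℂ) = 
    _ * ∑ x, ρ.character x * 
      (Nat.card {g | (g⁻¹ * x * g) 1 0 = 0 ∧ (g⁻¹ * x * g) 0 1 = 0} : ℂ) + _ at hid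
  rw [hB, hT] at hid
  have hG : Nat.card (SpecialLinearGroup (Fin 2) F) ≠ 0 := Nat.card_pos.ne'
  have hN : Nat.card F * Nat.card Fˣ ≠ 0 := mul_ne_zero Nat.card_pos.ne' Nat.card_pos.ne'
  have hC : Nat.card (Subgroup.centralizer {y}) ≠ 0 := Nat.card_pos.ne'
  have hid2 : Nat.card F * Nat.card Fˣ * (Nat.card (Subgroup.centralizer {y}) *
      finrank ℂ (Representation.invariants (ρ.comp (Subgroup.centralizer {y}).subtype))) +
      Nat.card (SpecialLinearGroup (Fin 2) F) * (2 * finrank ℂ (borelFixed ρ ψ)) =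
      Nat.card (SpecialLinearGroup (Fin 2) F) * finrank ℂ (torusFixed ρ) := by
    refine mul_left_cancel₀ hN ?_
    have hid3 := hid
    push_cast at hid3
    have : (((Nat.card F * Nat.card Fˣ : ℕ)) : ℂ) ≠ 0 := Nat.cast_ne_zero.2 hN
    rw [← Nat.cast_inj (R := ℂ)]
    push_cast
    linear_combination hid3
  constructor
  · intro h
    rw [h, mul_zero, mul_zero, zero_add] at hid2
    exact (mul_left_cancel₀ hG hid2).symm
  · intro h
    rw [h] at hid2
    simpa [hN, hC] using hid2

end nonsplit

section cyclic

variable {F : Type} [Field F]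

theorem exists_isNonsplit [Finite F] : ∃ t : F, IsNonsplit t := by
  classical
  have := Fintype.ofFinite F
  by_contra! h
  have hs : Function.Surjective fun r : Fˣ => (r : F) + (r : F)⁻¹ := fun t => by
    have ht := h t
    simp only [IsNonsplit, not_forall, not_not] at ht
    obtain ⟨r, hr⟩ := ht
    have hr0 : r ≠ 0 := fun h => by simp [h] at hr
    refine ⟨Units.mk0 r hr0, ?_⟩
    simp only [Units.val_mk0]
    field_simp
    linear_combination hr
  have h1 := Fintype.card_le_of_surjective _ hs
  rw [Fintype.card_units] at h1
  have h2 := Fintype.card_pos (α := F)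
  omega

theorem isCyclic_centralizer [Finite F] {y : SpecialLinearGroup (Fin 2) F}
    (hy : IsNonsplit (y 0 0 + y 1 1)) : IsCyclic (Subgroup.centralizer {y}) := by
  have hc := hy.one_zero_ne_zero
  have hd := det_eq y
  let K := AlgebraicClosure F
  let a : F →+* K := algebraMap F K
  obtain ⟨z, hz⟩ : ∃ z : K, a (y 1 0) * z ^ 2 + a (y 1 1 - y 0 0) * z - a (y 0 1) = 0 := by
    have hdeg := Polynomial.degree_quadratic (a := a (y 1 0)) (b := a (y 1 1 - y 0 0))
      (c := -a (y 0 1)) ((map_ne_zero a).2 hc)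
    obtain ⟨z, hz⟩ := IsAlgClosed.exists_root _ (hdeg.symm ▸ two_ne_zero)
    refine ⟨z, ?_⟩
    simpa [sub_eq_add_neg] using hz
  have hcomm (g : Subgroup.centralizer {y}) :
      g.1 0 1 * y 1 0 = y 0 1 * g.1 1 0 ∧ (g.1 1 1 - g.1 0 0) * y 1 0 =
        g.1 1 0 * (y 1 1 - y 0 0) := by
    have h := ext_iff_entries.1 (Subgroup.mem_centralizer_singleton_iff.1 g.2)
    simp only [mul_apply'] at h
    exact ⟨by linear_combination h.1, by linear_combination h.2.2.1⟩
  have heig (g : Subgroup.centralizer {y}) :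
      a (g.1 0 0) * z + a (g.1 0 1) = (a (g.1 1 0) * z + a (g.1 1 1)) * z := by
    refine mul_right_cancel₀ ((map_ne_zero a).2 hc) ?_
    have h1 := congrArg a (hcomm g).1
    have h2 := congrArg a (hcomm g).2
    simp only [map_mul, map_sub] at h1 h2 hz
    linear_combination h1 - z * h2 - a (g.1 1 0) * hz
  let f : Subgroup.centralizer {y} →* K :=
    { toFun := fun g => a (g.1 1 0) * z + a (g.1 1 1)
      map_one' := by simp
      map_mul' := fun g h => by
        simp only [Subgroup.coe_mul, mul_apply', map_add, map_mul]
        linear_combination a (g.1 1 0) * heig h }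
  refine isCyclic_of_injective_ringHom (f := f) fun g h hgh => ?_
  change a (g.1 1 0) * z + a (g.1 1 1) = a (h.1 1 0) * z + a (h.1 1 1) at hgh
  have h10 : g.1 1 0 = h.1 1 0 := by
    by_contra hne
    have hne' := sub_ne_zero.2 hne
    obtain ⟨w, rfl⟩ : ∃ w, z = a w := by
      refine ⟨(h.1 1 1 - g.1 1 1) / (g.1 1 0 - h.1 1 0), ?_⟩
      rw [map_div₀, eq_div_iff ((map_ne_zero a).2 hne'), map_sub, map_sub]
      linear_combination hgh
    have hw : y 1 0 * w ^ 2 + (y 1 1 - y 0 0) * w - y 0 1 = 0 := a.injective (by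
      simpa using hz)
    refine hy (y 1 0 * w + y 1 1) ?_
    linear_combination y 1 0 * hw - hd
  have h11 : g.1 1 1 = h.1 1 1 := a.injective (by
    rw [h10] at hgh; exact add_left_cancel hgh)
  obtain ⟨g1, g2⟩ := hcomm g
  obtain ⟨h1, h2⟩ := hcomm h
  refine Subtype.ext (ext_iff_entries.2 ⟨?_, ?_, h10, h11⟩)
  · refine mul_right_cancel₀ hc ?_
    linear_combination h2 - g2 - (y 1 1 - y 0 0) * h10 + y 1 0 * h11
  · refine mul_right_cancel₀ hc ?_
    linear_combination g1 - h1 + y 0 1 * h10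

end cyclic

section fixed

/-- The elements fixing a vector. -/
def fixer {G V : Type*} [Group G] [AddCommGroup V] [Module ℂ V] (ρ : Representation ℂ G V)
    (v : V) : Subgroup G where
  carrier := {g | ρ g v = v}
  one_mem' := by simp
  mul_mem' {g h} hg hh := by
    rw [Set.mem_ofPred_eq] at *
    rw [map_mul, Module.End.mul_apply, hh, hg]
  inv_mem' {g} hg := by
    rw [Set.mem_ofPred_eq] at *
    nth_rewrite 1 [← hg]
    rw [← Module.End.mul_apply, ← map_mul, inv_mul_cancel, map_one, Module.End.one_apply]

variable {F : Type} [Field F] [Fintype F] [DecidableEq F] {V : Type*} [AddCommGroup V] [Module ℂ V]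
  [FiniteDimensional ℂ V]
  {ρ : Representation ℂ (SpecialLinearGroup (Fin 2) F) V} {ψ : AddChar F ℂ}

theorem exists_fixed_of_isNonsplit (hρ : ρ.IsIrreducible) (hnt : ∃ g, ρ g ≠ 1)
    (hTB : finrank ℂ (torusFixed ρ) ≠ 2 * finrank ℂ (borelFixed ρ ψ))
    {y : SpecialLinearGroup (Fin 2) F} (hy : IsNonsplit (y 0 0 + y 1 1)) :
    ∃ v, v ≠ 0 ∧ ρ y v = v := by
  have h := (finrank_invariants_centralizer (ψ := ψ) hρ hnt hy).not.2 hTB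
  rw [Submodule.finrank_eq_zero] at h
  obtain ⟨v, hv, hv0⟩ := Submodule.exists_mem_ne_zero_of_ne_bot h
  exact ⟨v, hv0, hv ⟨y, Subgroup.mem_centralizer_singleton_iff.2 rfl⟩⟩

theorem exists_forall_fixed_eq_zero (hρ : ρ.IsIrreducible) (hnt : ∃ g, ρ g ≠ 1)
    (hTB : finrank ℂ (torusFixed ρ) = 2 * finrank ℂ (borelFixed ρ ψ)) :
    ∃ y, ∀ v, ρ y v = v → v = 0 := by
  obtain ⟨t, ht⟩ := exists_isNonsplit (F := F)
  obtain ⟨y, rfl⟩ : ∃ y : SpecialLinearGroup (Fin 2) F, y 0 0 + y 1 1 = t :=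
    ⟨ofEntries 0 (-1) 1 t (by simp), by simp⟩
  have h := (finrank_invariants_centralizer (ψ := ψ) hρ hnt ht).2 hTB
  rw [Submodule.finrank_eq_zero] at h
  have := isCyclic_centralizer ht
  obtain ⟨c, hc⟩ := IsCyclic.exists_generator (α := Subgroup.centralizer {y})
  refine ⟨c, fun v hv => ?_⟩
  rw [← Submodule.mem_bot ℂ, ← h]
  intro g
  exact (Subgroup.zpowers_le (H := fixer (ρ.comp (Subgroup.centralizer {y}).subtype) v)).2 hv (hc g)

omit [DecidableEq F] [FiniteDimensional ℂ V] in
theorem character_eq_zero_of_trace_eq_zero (hψ : ψ.IsPrimitive)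
    (h0 : weightSpace ρ ψ 0 = ⊥) (h2 : (2 : F) ≠ 0) {i : F} (hi : i ^ 2 = -1)
    {x : SpecialLinearGroup (Fin 2) F} (hx : x 0 0 + x 1 1 = 0) :
    ρ.character x = 0 := by
  have hz : weightProj ρ ψ 0 = 0 := LinearMap.ext fun v => by
    have := weightProj_mem ρ ψ 0 v
    rw [h0] at this
    exact (Submodule.mem_bot ℂ).1 this
  rcases exists_conj x with h | ⟨g, r, hr, hg⟩ | ⟨g, z, hg⟩
  · exact absurd (by rw [hx, hi]; ring) (h i)
  · rw [← character_conj ρ g, hg]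
    exact (trace_torus ρ hψ hr).trans (by rw [hz, mul_zero, map_zero])
  · rw [← trace_conj g] at hx
    refine absurd ?_ h2
    rcases hg with hg | hg <;> rw [hg] at hx <;> simp [upper] at hx
    · linear_combination hx
    · linear_combination -hx

theorem finrank_torusFixed_ne_one (hψ : ψ.IsPrimitive) (hneg : ρ (-1) = 1)
    (h0 : weightSpace ρ ψ 0 = ⊥) (h2 : (2 : F) ≠ 0) {i : F} (hi : i ^ 2 = -1) :
    finrank ℂ (torusFixed ρ) ≠ 1 := by
  intro h1
  have htr : LinearMap.trace ℂ V (ρ weyl * torusProj ρ) = 0 := by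
    rw [torusProj, mul_smul_comm, Finset.mul_sum, map_smul, map_sum, Finset.sum_eq_zero, smul_zero]
    intro r _
    rw [← map_mul]
    exact character_eq_zero_of_trace_eq_zero hψ h0 h2 hi (by simp [weyl, torus])
  obtain ⟨⟨v, hv⟩, hv0, hspan⟩ := finrank_eq_one_iff'.1 h1
  have hwv : ρ weyl v ∈ torusFixed ρ := fun r => by rw [map_torus_map_weyl, hv]
  obtain ⟨ε, hε⟩ := hspan ⟨_, hwv⟩
  have hε' : ε • v = ρ weyl v := congrArg Subtype.val hε
  have hmul : ρ weyl * torusProj ρ = ε • torusProj ρ := LinearMap.ext fun w => by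
    obtain ⟨c, hc⟩ := hspan ⟨_, (isProj_torusProj ρ).map_mem w⟩
    have hc' : c • v = torusProj ρ w := congrArg Subtype.val hc
    rw [Module.End.mul_apply, LinearMap.smul_apply, ← hc', map_smul, ← hε', smul_comm]
  rw [hmul, map_smul, (isProj_torusProj ρ).trace, h1, Nat.cast_one, smul_eq_mul, mul_one] at htr
  have hv0' : v = 0 := by
    rw [← map_weyl_map_weyl hneg v, ← hε', htr, zero_smul, map_zero]
  exact hv0 (Subtype.ext hv0')

end fixed

section additive_characters

variable {F : Type} [Field F] [Fintype F] {ψ : AddChar F ℂ}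

theorem prime_card_of_forall_ne_zero {z : F} (h : ∀ a ≠ 0, ψ (a * z) ≠ 1) :
    (Fintype.card F).Prime := by
  classical
  obtain ⟨p, hp⟩ := CharP.exists F
  have hpp : p.Prime := CharP.char_is_prime F p
  have hinj : Set.InjOn (fun a => ψ (a * z)) (Finset.univ : Finset F) := by
    intro a _ b _ hab
    by_contra hne
    refine h (a - b) (sub_ne_zero.2 hne) ?_
    have hab' : ψ (a * z) = ψ (b * z) := hab
    rw [sub_mul, sub_eq_add_neg, AddChar.map_add_eq_mul, hab', ← AddChar.map_add_eq_mul,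
      add_neg_cancel, AddChar.map_zero_eq_one]
  have hmaps : Set.MapsTo (fun a => ψ (a * z)) (Finset.univ : Finset F)
      (Polynomial.nthRootsFinset p (1 : ℂ)) := by
    intro a _
    rw [SetLike.mem_coe, Polynomial.mem_nthRootsFinset hpp.pos, ← AddChar.map_nsmul_eq_pow]
    simp
  have hle := Finset.card_le_card_of_injOn _ hmaps hinj
  replace hle : Fintype.card F ≤ p := by
    refine hle.trans (le_trans ?_ (Polynomial.card_nthRoots p (1 : ℂ)))
    classical
    rw [Polynomial.nthRootsFinset_def]
    exact Multiset.toFinset_card_le _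
  obtain ⟨n, -, hn⟩ := FiniteField.card F p
  have hpn : p ^ 1 ≤ p ^ (n : ℕ) := Nat.pow_le_pow_right hpp.pos n.2
  rw [pow_one, ← hn] at hpn
  rwa [le_antisymm hle hpn]

theorem apply_ne_one_of_prime_card (hF : (Fintype.card F).Prime) (hψ : ψ ≠ 1) {a : F}
    (ha : a ≠ 0) : ψ a ≠ 1 := by
  intro h
  have := Fact.mk hF
  refine hψ (DFunLike.ext _ _ fun x => ?_)
  obtain ⟨n, rfl⟩ := mem_zmultiples_of_prime_card (p := Fintype.card F)
    (Nat.card_eq_fintype_card) ha (g' := x)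
  change ψ (n • a) = _
  rw [AddChar.map_zsmul_eq_zpow, h, _root_.one_zpow]
  exact (AddChar.one_apply _).symm

end additive_characters

section fixed_points

variable {F : Type} [Field F] [Fintype F] [DecidableEq F] {V : Type*} [AddCommGroup V] [Module ℂ V]
  [FiniteDimensional ℂ V]
  {ρ : Representation ℂ (SpecialLinearGroup (Fin 2) F) V} {ψ : AddChar F ℂ}

omit [DecidableEq F] [FiniteDimensional ℂ V] in
theorem forall_fixed_upper_eq_zero_iff (hψ : ψ.IsPrimitive) (z : F) :
    (∀ v, ρ (upper z) v = v → v = 0) ↔ ∀ a, ψ (a * z) = 1 → weightSpace ρ ψ a = ⊥ := by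
  constructor
  · intro h a ha
    refine (Submodule.eq_bot_iff _).2 fun v hv => h v ?_
    rw [mem_weightSpace.1 hv, ha, one_smul]
  · intro h v hv
    have hv' : v = ∑ a, weightProj ρ ψ a v := by
      rw [← LinearMap.sum_apply, sum_weightProj ρ hψ, Module.End.one_apply]
    rw [hv']
    refine Finset.sum_eq_zero fun a _ => ?_
    have h1 := weightProj_upper (ρ := ρ) (ψ := ψ) a z v
    rw [hv] at h1
    by_cases ha : ψ (a * z) = 1
    · have := weightProj_mem ρ ψ a v
      rw [h a ha] at this
      exact (Submodule.mem_bot ℂ).1 this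
    · have h2 : (ψ (a * z) - 1) • weightProj ρ ψ a v = 0 := by
        rw [sub_smul, one_smul, ← h1, sub_self]
      exact (smul_eq_zero.1 h2).resolve_left (sub_ne_zero.2 ha)

omit [Fintype F] [DecidableEq F] [FiniteDimensional ℂ V] in
theorem forall_fixed_conj {g x : SpecialLinearGroup (Fin 2) F}
    (h : ∀ v, ρ x v = v → v = 0) (v : V) (hv : ρ (g⁻¹ * x * g) v = v) : v = 0 := by
  have h1 : ρ g v = 0 := h _ (by
    nth_rewrite 2 [← hv]
    rw [← Module.End.mul_apply, ← Module.End.mul_apply, ← map_mul, ← map_mul]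
    congr 2; group)
  have h2 := congrArg (ρ g⁻¹) h1
  rwa [← Module.End.mul_apply, ← map_mul, inv_mul_cancel, map_one, map_zero] at h2

theorem exists_forall_fixed_eq_zero_iff (hρ : ρ.IsIrreducible) (hψ : ψ.IsPrimitive)
    (hneg : ρ (-1) = 1) (hnt : ∃ g, ρ g ≠ 1) :
    (∃ x, ∀ v, ρ x v = v → v = 0) ↔
      finrank ℂ (torusFixed ρ) = 2 * finrank ℂ (borelFixed ρ ψ) ∨
        ∃ z, ∀ a, ψ (a * z) = 1 → weightSpace ρ ψ a = ⊥ := by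
  constructor
  · rintro ⟨x, hx⟩
    rcases exists_conj x with h | ⟨g, r, -, hg⟩ | ⟨g, z, hg⟩
    · by_contra! hTB
      obtain ⟨v, hv0, hv⟩ := exists_fixed_of_isNonsplit hρ hnt hTB.1 h
      exact hv0 (hx v hv)
    · have hpos := (Nat.zero_le _).trans_lt (finrank_borelFixed_lt ρ hψ hneg hnt)
      have := Module.finrank_pos_iff.1 hpos
      obtain ⟨⟨v, hv⟩, hv0⟩ := exists_ne (0 : torusFixed ρ)
      refine absurd (Subtype.ext ?_) hv0
      exact forall_fixed_conj hx v (by rw [hg, hv])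
    · refine Or.inr ⟨z, (forall_fixed_upper_eq_zero_iff hψ z).1 fun v hv => ?_⟩
      refine forall_fixed_conj (g := g) hx v ?_
      rcases hg with hg | hg
      · rw [hg, hv]
      · rw [hg, map_neg hneg, hv]
  · rintro (h | ⟨z, hz⟩)
    · exact exists_forall_fixed_eq_zero hρ hnt h
    · exact ⟨_, (forall_fixed_upper_eq_zero_iff hψ z).2 hz⟩

end fixed_points

section main

variable {F : Type} [Field F] [Fintype F] [DecidableEq F] {V : Type*} [AddCommGroup V] [Module ℂ V]
  [FiniteDimensional ℂ V]
  {ρ : Representation ℂ (SpecialLinearGroup (Fin 2) F) V} {ψ : AddChar F ℂ}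

theorem finrank_eq_add (hψ : ψ.IsPrimitive) : finrank ℂ V =
    finrank ℂ (weightSpace ρ ψ 0) + ∑ a : Fˣ, finrank ℂ (weightSpace ρ ψ (a : F)) := by
  rw [← sum_finrank_weightSpace ρ hψ, sum_eq_add_sum_units]

theorem exists_units_mul_self {F : Type} [Field F] [Finite F] (h2 : (2 : F) = 0) (r : Fˣ) :
    ∃ s : Fˣ, r = s * s := by
  obtain ⟨s, hs⟩ := FiniteField.isSquare_of_char_two
    (neg_one_eq_one_iff.1 (by linear_combination -h2)) (r : F)
  have hs0 : s ≠ 0 := fun h => r.ne_zero (by rw [hs, h, mul_zero])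
  exact ⟨Units.mk0 s hs0, Units.ext hs⟩

omit [FiniteDimensional ℂ V] in
theorem sum_finrank_weightSpace_units_of_forall_eq_one
    (h : ∀ a : F, a ≠ 0 → finrank ℂ (weightSpace ρ ψ a) = 1) :
    ∑ a : Fˣ, finrank ℂ (weightSpace ρ ψ (a : F)) = Fintype.card Fˣ := by
  rw [Finset.sum_congr rfl fun (a : Fˣ) _ => h a a.ne_zero]
  simp

theorem finrank_torusFixed_of_two_eq_zero (hρ : ρ.IsIrreducible) (hψ : ψ.IsPrimitive)
    (hneg : ρ (-1) = 1) (hnt : ∃ g, ρ g ≠ 1) (h2 : (2 : F) = 0) :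
    finrank ℂ (torusFixed ρ) = finrank ℂ (borelFixed ρ ψ) + 1 ∧
      ∀ a : F, a ≠ 0 → finrank ℂ (weightSpace ρ ψ a) = 1 := by
  have hb (a : F) (ha : a ≠ 0) :
      finrank ℂ (weightSpace ρ ψ a) = finrank ℂ (weightSpace ρ ψ 1) := by
    obtain ⟨s, hs⟩ := exists_units_mul_self h2 (Units.mk0 a ha)
    have hs' : a = 1 * (s : F) ^ 2 := by
      rw [one_mul, sq, ← Units.val_mul, ← hs, Units.val_mk0]
    rw [hs', finrank_weightSpace_mul_sq]
  have hd : Fintype.card {r : Fˣ // (r : F) ^ 2 = 1} = 1 := by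
    rw [Fintype.card_eq_one_iff]
    refine ⟨⟨1, by simp⟩, fun r => Subtype.ext (Units.ext ?_)⟩
    have h := r.2
    have : ((r : Fˣ) - 1 : F) ^ 2 = 0 := by linear_combination h + (1 - (r.1 : F)) * h2
    exact sub_eq_zero.1 (pow_eq_zero_iff two_ne_zero |>.1 this)
  have h1 := card_mul_finrank_torusFixed ρ hψ hneg
  have h3 := finrank_borelFixed_lt ρ hψ hneg hnt
  have h4 := finrank_weightSpace_le_one ρ hρ hψ (one_ne_zero (α := F))
  rw [hd, one_mul, Finset.sum_congr rfl fun (a : Fˣ) _ => hb a a.ne_zero, Finset.sum_const,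
    smul_eq_mul, Finset.card_univ, ← mul_add] at h1
  have h5 := mul_left_cancel₀ Fintype.card_ne_zero h1
  have h6 : finrank ℂ (weightSpace ρ ψ 1) = 1 := by omega
  exact ⟨by omega, fun a ha => (hb a ha).trans h6⟩

theorem exists_forall_fixed_eq_zero_iff_of_two_eq_zero (hρ : ρ.IsIrreducible)
    (hψ : ψ.IsPrimitive) (hψ1 : ψ ≠ 1) (hneg : ρ (-1) = 1)
    (hnt : ∃ g, ρ g ≠ 1) (h2 : (2 : F) = 0) :
    (∃ x, ∀ v, ρ x v = v → v = 0) ↔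
      Fintype.card F = 2 ∧ finrank ℂ V = 1 ∨ finrank ℂ V = Fintype.card F := by
  obtain ⟨hT, hb⟩ := finrank_torusFixed_of_two_eq_zero hρ hψ hneg hnt h2
  have hdim := finrank_eq_add (ρ := ρ) hψ
  rw [sum_finrank_weightSpace_units_of_forall_eq_one hb, Fintype.card_units] at hdim
  have hq : 1 < Fintype.card F := Fintype.one_lt_card
  rw [exists_forall_fixed_eq_zero_iff hρ hψ hneg hnt, hT]
  constructor
  · rintro (h | ⟨z, hz⟩)
    · have := (weightSpace_of_borelFixed_ne_bot hψ hρ hneg hnt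
        (fun h0 => by rw [h0, finrank_bot] at h; omega)).2 0
      omega
    · have h0 : weightSpace ρ ψ 0 = ⊥ := hz 0 (by simp)
      rw [h0, finrank_bot] at hdim
      have hp : (Fintype.card F).Prime := prime_card_of_forall_ne_zero fun a ha hab => by
        have := hb a ha
        rw [hz a hab, finrank_bot] at this
        exact zero_ne_one this
      have heven : Fintype.card F % 2 = 0 :=
        FiniteField.even_card_iff_char_two.1 (neg_one_eq_one_iff.1 (by linear_combination -h2))
      have := hp.eq_one_or_self_of_dvd 2 (Nat.dvd_of_mod_eq_zero heven)
      omega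
  · rintro (⟨h, h'⟩ | h)
    · refine Or.inr ⟨1, fun a ha => ?_⟩
      have ha0 : a = 0 := by
        by_contra ha0
        refine apply_ne_one_of_prime_card (h ▸ Nat.prime_two) hψ1 ha0 ?_
        rwa [mul_one] at ha
      rw [ha0]
      exact Submodule.finrank_eq_zero.1 (by omega)
    · have hB := borelFixed_ne_bot_of_finrank_weightSpace_zero_eq_one (ρ := ρ) (ψ := ψ) hneg
        (by omega) fun r => (exists_units_mul_self h2 r).imp fun s hs => by rw [hs]
      have := (weightSpace_of_borelFixed_ne_bot hψ hρ hneg hnt hB).1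
      omega

theorem card_mul_finrank_torusFixed_of_two_ne_zero (hψ : ψ.IsPrimitive) (hneg : ρ (-1) = 1)
    (h2 : (2 : F) ≠ 0) :
    Fintype.card Fˣ * finrank ℂ (torusFixed ρ) =
      Fintype.card Fˣ * finrank ℂ (borelFixed ρ ψ) +
        2 * ∑ a : Fˣ, finrank ℂ (weightSpace ρ ψ (a : F)) := by
  have hd : Fintype.card {r : Fˣ // (r : F) ^ 2 = 1} = 2 := by
    have hne : (1 : Fˣ) ≠ -1 := fun h => h2 (by
      have := congrArg Units.val h
      rw [Units.val_neg, Units.val_one] at this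
      linear_combination this)
    have heq : (Finset.univ.filter fun r : Fˣ => (r : F) ^ 2 = 1) = {1, -1} := by
      ext r
      rw [Finset.mem_filter_univ, Finset.mem_insert, Finset.mem_singleton, sq_eq_one_iff,
        Units.ext_iff, Units.ext_iff, Units.val_neg, Units.val_one]
    rw [Fintype.card_subtype, heq, Finset.card_pair hne]
  rw [card_mul_finrank_torusFixed ρ hψ hneg, hd]

theorem finrank_torusFixed_of_exists_weightSpace_eq_bot (hρ : ρ.IsIrreducible)
    (hψ : ψ.IsPrimitive) (hneg : ρ (-1) = 1) (hnt : ∃ g, ρ g ≠ 1) (h2 : (2 : F) ≠ 0) {a : F}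
    (ha : a ≠ 0) (hW : weightSpace ρ ψ a = ⊥) :
    finrank ℂ (torusFixed ρ) = finrank ℂ (borelFixed ρ ψ) + 1 := by
  have h1 := card_mul_finrank_torusFixed_of_two_ne_zero (ρ := ρ) hψ hneg h2
  have h3 := finrank_borelFixed_lt ρ hψ hneg hnt
  have h4 : ∑ a : Fˣ, finrank ℂ (weightSpace ρ ψ (a : F)) < ∑ _a : Fˣ, 1 :=
    Finset.sum_lt_sum (fun c _ => finrank_weightSpace_le_one ρ hρ hψ c.ne_zero)
      ⟨Units.mk0 a ha, Finset.mem_univ _, by rw [Units.val_mk0, hW, finrank_bot]; exact one_pos⟩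
  rw [Finset.sum_const, Finset.card_univ, smul_eq_mul, mul_one] at h4
  by_contra hne
  have h5 : Fintype.card Fˣ * (finrank ℂ (borelFixed ρ ψ) + 2) ≤
      Fintype.card Fˣ * finrank ℂ (torusFixed ρ) := Nat.mul_le_mul_left _ (by omega)
  rw [mul_add] at h5
  omega

theorem sum_finrank_weightSpace_units_le (hρ : ρ.IsIrreducible) (hψ : ψ.IsPrimitive) :
    ∑ a : Fˣ, finrank ℂ (weightSpace ρ ψ (a : F)) ≤ Fintype.card Fˣ := by
  refine (Finset.sum_le_sum fun c _ =>
    finrank_weightSpace_le_one ρ hρ hψ (Units.ne_zero c)).trans ?_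
  simp

theorem exists_eq_mul_sq_or_neg_mul_sq {F : Type} [Field F] [Fintype F]
    (hi : ¬ IsSquare (-1 : F)) {a c : F} (ha : a ≠ 0) (hc : c ≠ 0) :
    ∃ r : Fˣ, c = a * (r : F) ^ 2 ∨ c = -a * (r : F) ^ 2 := by
  classical
  have key {x : F} (hx : x ≠ 0) (h : IsSquare x) : ∃ r : Fˣ, x = (r : F) ^ 2 := by
    obtain ⟨s, rfl⟩ := h
    exact ⟨Units.mk0 s (left_ne_zero_of_mul hx), (sq s).symm⟩
  by_cases h : IsSquare (c / a)
  · obtain ⟨r, hr⟩ := key (div_ne_zero hc ha) h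
    exact ⟨r, Or.inl (by rw [← hr]; field_simp)⟩
  · have h' : IsSquare (-1 * (c / a)) := by
      rw [← quadraticChar_one_iff_isSquare (mul_ne_zero (by simp) (div_ne_zero hc ha)), map_mul,
        quadraticChar_neg_one_iff_not_isSquare.2 hi, quadraticChar_neg_one_iff_not_isSquare.2 h]
      norm_num
    obtain ⟨r, hr⟩ := key (mul_ne_zero (by simp) (div_ne_zero hc ha)) h'
    exact ⟨r, Or.inr (by rw [← hr]; field_simp)⟩

theorem finrank_borelFixed_eq_zero (hρ : ρ.IsIrreducible) (hψ : ψ.IsPrimitive)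
    (hneg : ρ (-1) = 1) (hnt : ∃ g, ρ g ≠ 1) (h0 : weightSpace ρ ψ 0 = ⊥) :
    finrank ℂ (borelFixed ρ ψ) = 0 := by
  by_contra h
  have := (weightSpace_of_borelFixed_ne_bot hψ hρ hneg hnt
    (fun h' => h (by rw [h', finrank_bot]))).2 0
  rw [h0, finrank_bot] at this
  exact zero_ne_one this

theorem not_isSquare_neg_one_of_finrank_torusFixed_eq_one (hψ : ψ.IsPrimitive)
    (hneg : ρ (-1) = 1) (h0 : weightSpace ρ ψ 0 = ⊥) (h2 : (2 : F) ≠ 0)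
    (hT : finrank ℂ (torusFixed ρ) = 1) : ¬ IsSquare (-1 : F) := fun ⟨i, hi⟩ =>
  finrank_torusFixed_ne_one hψ hneg h0 h2 (i := i) (by rw [hi, sq]) hT

theorem prime_card_of_weightSpace_eq_bot (hρ : ρ.IsIrreducible) (hψ : ψ.IsPrimitive)
    (hneg : ρ (-1) = 1) (hnt : ∃ g, ρ g ≠ 1) (h2 : (2 : F) ≠ 0) {z : F}
    (hz : ∀ a, ψ (a * z) = 1 → weightSpace ρ ψ a = ⊥) : (Fintype.card F).Prime := by
  have h0 : weightSpace ρ ψ 0 = ⊥ := hz 0 (by simp)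
  have hB := finrank_borelFixed_eq_zero hρ hψ hneg hnt h0
  refine prime_card_of_forall_ne_zero (ψ := ψ) (z := z) fun a ha haz => ?_
  have hT := finrank_torusFixed_of_exists_weightSpace_eq_bot hρ hψ hneg hnt h2 ha (hz a haz)
  rw [hB, zero_add] at hT
  have hi := not_isSquare_neg_one_of_finrank_torusFixed_eq_one hψ hneg h0 h2 hT
  have hna : weightSpace ρ ψ (-a) = ⊥ :=
    hz _ (by rw [neg_mul, AddChar.map_neg_eq_inv, haz, inv_one])
  have h1 := card_mul_finrank_torusFixed_of_two_ne_zero (ρ := ρ) hψ hneg h2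
  rw [hT, hB, Finset.sum_eq_zero] at h1
  · exact Fintype.card_ne_zero (α := Fˣ) (by omega)
  · intro c _
    obtain ⟨r, hr | hr⟩ := exists_eq_mul_sq_or_neg_mul_sq hi ha c.ne_zero
    · rw [hr, finrank_weightSpace_mul_sq, hz a haz, finrank_bot]
    · rw [hr, finrank_weightSpace_mul_sq, hna, finrank_bot]

theorem weightSpace_zero_eq_bot_of_finrank_eq (hρ : ρ.IsIrreducible) (hψ : ψ.IsPrimitive)
    (hneg : ρ (-1) = 1) (hnt : ∃ g, ρ g ≠ 1) (h2 : (2 : F) ≠ 0)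
    (hdim : finrank ℂ V = Fintype.card F - 1 ∨ finrank ℂ V = (Fintype.card F - 1) / 2) :
    weightSpace ρ ψ 0 = ⊥ := by
  by_contra h0
  have hpos : 0 < finrank ℂ (weightSpace ρ ψ 0) :=
    Nat.pos_of_ne_zero fun h => h0 (Submodule.finrank_eq_zero.1 h)
  have hV := finrank_eq_add (ρ := ρ) hψ
  have h1 := card_mul_finrank_torusFixed_of_two_ne_zero (ρ := ρ) hψ hneg h2
  have h3 := finrank_borelFixed_lt ρ hψ hneg hnt
  have hN := Fintype.card_units (α := F)
  have h5 : Fintype.card Fˣ * (finrank ℂ (borelFixed ρ ψ) + 1) ≤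
      Fintype.card Fˣ * finrank ℂ (torusFixed ρ) := Nat.mul_le_mul_left _ h3
  rw [mul_add] at h5
  have hlt : ∑ a : Fˣ, finrank ℂ (weightSpace ρ ψ (a : F)) < Fintype.card Fˣ := by omega
  obtain ⟨a, ha⟩ : ∃ a : Fˣ, weightSpace ρ ψ (a : F) = ⊥ := by
    by_contra! hne
    refine hlt.not_ge ?_
    rw [← Finset.card_univ, Finset.card_eq_sum_ones]
    exact Finset.sum_le_sum fun a _ => Submodule.one_le_finrank_iff.2 (hne a)
  have hT := finrank_torusFixed_of_exists_weightSpace_eq_bot hρ hψ hneg hnt h2 a.ne_zero ha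
  have hW0 := finrank_weightSpace_zero_eq_one hρ hneg h0 ha
  rw [hT, mul_add] at h1
  have hq : Fintype.card F = 3 := by
    have : 1 < Fintype.card F := Fintype.one_lt_card
    omega
  have hB := borelFixed_ne_bot_of_finrank_weightSpace_zero_eq_one (ρ := ρ) (ψ := ψ) hneg hW0
    fun r => ⟨1, by
      have hr : (r : F) ^ 2 = 1 := by
        have := FiniteField.pow_card_sub_one_eq_one (r : F) r.ne_zero
        rwa [hq] at this
      rw [map_torus_eq_one ρ hneg hr, map_torus_eq_one ρ hneg (by simp)]⟩
  have := (weightSpace_of_borelFixed_ne_bot hψ hρ hneg hnt hB).2 a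
  rw [ha, finrank_bot] at this
  exact zero_ne_one this

theorem exists_forall_fixed_eq_zero_iff_of_two_ne_zero (hρ : ρ.IsIrreducible)
    (hψ : ψ.IsPrimitive) (hψ1 : ψ ≠ 1) (hneg : ρ (-1) = 1)
    (hnt : ∃ g, ρ g ≠ 1) (h2 : (2 : F) ≠ 0) :
    (∃ x, ∀ v, ρ x v = v → v = 0) ↔
      Fintype.card F = 3 ∧ finrank ℂ V = 1 ∨
      (Fintype.card F).Prime ∧ finrank ℂ V = Fintype.card F - 1 ∨
      (Fintype.card F).Prime ∧ 3 < Fintype.card F ∧ Fintype.card F % 4 = 3 ∧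
        finrank ℂ V = (Fintype.card F - 1) / 2 := by
  have hdim := finrank_eq_add (ρ := ρ) hψ
  have h1 := card_mul_finrank_torusFixed_of_two_ne_zero (ρ := ρ) hψ hneg h2
  have hN := Fintype.card_units (α := F)
  have hN0 : 0 < Fintype.card Fˣ := Fintype.card_pos
  rw [exists_forall_fixed_eq_zero_iff hρ hψ hneg hnt]
  constructor
  · rintro (h | ⟨z, hz⟩)
    · have hlt := finrank_borelFixed_lt ρ hψ hneg hnt
      obtain ⟨hB, hb⟩ := weightSpace_of_borelFixed_ne_bot hψ hρ hneg hnt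
        (fun h0 => by rw [h0, finrank_bot] at h hlt; omega)
      rw [sum_finrank_weightSpace_units_of_forall_eq_one fun a _ => hb a, h, hB] at h1
      omega
    · have hp := prime_card_of_weightSpace_eq_bot hρ hψ hneg hnt h2 hz
      have h0 : weightSpace ρ ψ 0 = ⊥ := hz 0 (by simp)
      have hB := finrank_borelFixed_eq_zero hρ hψ hneg hnt h0
      have hle := sum_finrank_weightSpace_units_le (ρ := ρ) hρ hψ
      have hlt := finrank_borelFixed_lt ρ hψ hneg hnt
      rw [hB] at hlt h1
      rw [h0, finrank_bot, zero_add] at hdim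
      rw [← hdim] at h1 hle
      have hT : Fintype.card Fˣ * finrank ℂ (torusFixed ρ) ≤ Fintype.card Fˣ * 2 := by omega
      replace hT := Nat.le_of_mul_le_mul_left hT hN0
      obtain hT | hT : finrank ℂ (torusFixed ρ) = 1 ∨ finrank ℂ (torusFixed ρ) = 2 := by omega
      · have h4 : Fintype.card F % 4 = 3 := by
          by_contra h4
          exact not_isSquare_neg_one_of_finrank_torusFixed_eq_one hψ hneg h0 h2 hT
            (FiniteField.isSquare_neg_one_iff.2 h4)
        rw [hT] at h1
        obtain h3 | h3 : Fintype.card F = 3 ∨ 3 < Fintype.card F := by omega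
        · exact Or.inl ⟨h3, by omega⟩
        · exact Or.inr (Or.inr ⟨hp, h3, h4, by omega⟩)
      · rw [hT] at h1
        exact Or.inr (Or.inl ⟨hp, by omega⟩)
  · intro h
    have hp : (Fintype.card F).Prime := by
      rcases h with h | h | h
      · exact h.1 ▸ Nat.prime_three
      · exact h.1
      · exact h.1
    have h0 := weightSpace_zero_eq_bot_of_finrank_eq hρ hψ hneg hnt h2 (by omega)
    refine Or.inr ⟨1, fun a ha => ?_⟩
    by_cases ha0 : a = 0
    · rw [ha0, h0]
    · rw [mul_one] at ha
      exact absurd ha (apply_ne_one_of_prime_card hp hψ1 ha0)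

end main

end SL2

theorem FDRep.isIrreducible_of_simple {G : Type} [Monoid G] (V : FDRep ℂ G) (hV : Simple V) :
    Representation.IsIrreducible V.ρ where
  exists_pair_ne := by
    refine ⟨⊥, ⊤, fun h => id_nonzero V ?_⟩
    have h0 (v : V) : v = 0 := by
      have : v ∈ (⊥ : Subrepresentation V.ρ) := h ▸ Submodule.mem_top
      exact (Submodule.mem_bot ℂ).1 this
    ext v
    exact (h0 _).trans (h0 _).symm
  eq_bot_or_eq_top S := by
    let f : FDRep.of S.toRepresentation ⟶ V :=
      ⟨InducedCategory.homMk (ModuleCat.ofHom S.toSubmodule.subtype), fun g => rfl⟩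
    have : Mono f := ConcreteCategory.mono_of_injective f Subtype.val_injective
    by_cases h0 : f = 0
    · refine Or.inl (Subrepresentation.toSubmodule_injective ((Submodule.eq_bot_iff _).2 ?_))
      exact fun v hv => (ConcreteCategory.congr_hom h0 (⟨v, hv⟩ : S.toSubmodule) : f ⟨v, hv⟩ = 0)
    · have := isIso_of_mono_of_nonzero h0
      refine Or.inr (Subrepresentation.toSubmodule_injective (Submodule.eq_top_iff'.2 fun v => ?_))
      have h : f (inv f v) = v := ConcreteCategory.congr_hom (IsIso.inv_hom_id f) v
      exact h ▸ Subtype.prop (inv f v : S.toSubmodule)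

theorem Representation.IsIrreducible.comp_of_surjective {k G H V : Type*} [Monoid G] [Monoid H]
    [Field k] [AddCommGroup V] [Module k V] {ρ : Representation k H V} (hρ : ρ.IsIrreducible)
    {f : G →* H} (hf : Function.Surjective f) :
    Representation.IsIrreducible (ρ.comp f : Representation k G V) where
  exists_pair_ne := by
    refine ⟨⊥, ⊤, fun h => ?_⟩
    have h' : (⊥ : Subrepresentation ρ) = ⊤ :=
      Subrepresentation.toSubmodule_injective (congrArg Subrepresentation.toSubmodule h :)
    exact bot_ne_top h'
  eq_bot_or_eq_top S := by
    let T : Subrepresentation ρ := ⟨S.toSubmodule, fun h v hv => by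
      obtain ⟨g, rfl⟩ := hf h
      exact S.apply_mem_toSubmodule g hv⟩
    refine (hρ.eq_bot_or_eq_top T).imp (fun h => ?_) fun h => ?_ <;>
    exact Subrepresentation.toSubmodule_injective (congrArg Subrepresentation.toSubmodule h :)

theorem Representation.IsIrreducible.nontrivial {k G V : Type*} [Monoid G] [Field k]
    [AddCommGroup V] [Module k V] {ρ : Representation k G V} (hρ : ρ.IsIrreducible) :
    Nontrivial V := by
  by_contra h
  rw [not_nontrivial_iff_subsingleton] at h
  exact bot_ne_top (α := Subrepresentation ρ)
    (Subrepresentation.toSubmodule_injective (Subsingleton.elim _ _))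

theorem FDRep.not_isUnisingular_iff {G : Type} [Monoid G] (V : FDRep ℂ G) :
    ¬ V.IsUnisingular ↔ ∃ g, ∀ v, V.ρ g v = v → v = 0 := by
  rw [FDRep.IsUnisingular, not_forall]
  refine exists_congr fun g => ?_
  rw [Module.End.hasEigenvalue_iff, not_not, Submodule.eq_bot_iff]
  simp only [Module.End.mem_eigenspace_iff, one_smul]

theorem FDRep.exists_character_ne_one_iff {G : Type} [Group G] (V : FDRep ℂ G)
    (h : finrank ℂ V = 1) : (∃ g, V.character g ≠ 1) ↔ ∃ g, V.ρ g ≠ 1 := by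
  refine exists_congr fun g => not_congr ?_
  obtain ⟨c, hc⟩ : ∃ c : ℂ, V.ρ g = c • 1 := by
    obtain ⟨v, hv, hv'⟩ := finrank_eq_one_iff'.1 h
    obtain ⟨c, hc⟩ := hv' (V.ρ g v)
    refine ⟨c, LinearMap.ext fun w => ?_⟩
    obtain ⟨d, rfl⟩ := hv' w
    rw [map_smul, ← hc, LinearMap.smul_apply, Module.End.one_apply, smul_comm]
  have hV : (1 : Module.End ℂ V) ≠ 0 := by
    have := Module.nontrivial_of_finrank_pos (R := ℂ) (M := V) (by omega)
    exact one_ne_zero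
  rw [FDRep.character, hc, map_smul, LinearMap.trace_one, h, Nat.cast_one, smul_eq_mul, mul_one]
  refine ⟨fun h => by rw [h, one_smul], fun h' => ?_⟩
  exact smul_left_injective ℂ hV (h'.trans (one_smul ℂ _).symm)

/-- Let `F` be a finite field with `q` elements (so `q` is a prime power).
An irreducible complex character `χ` of `PSL₂(q)` is not unisingular iff one of:
(1) `q ∈ {2, 3}` and `χ` is a nontrivial character of degree 1;
(2) `q` is even and `χ(1) = q`;
(3) `q` is an odd prime and `χ(1) = q - 1`;
(4) `q > 3` is an odd prime with `q ≡ 3 (mod 4)` and `χ(1) = (q - 1) / 2`. -/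
theorem PSL2_not_unisingular_iff (q : ℕ) (F : Type) [Field F] [Fintype F]
    (hF : Fintype.card F = q) (V : FDRep ℂ (PSL2 F)) (hV : Simple V) :
    ¬ V.IsUnisingular ↔
      (((q = 2 ∨ q = 3) ∧ Module.finrank ℂ V = 1 ∧ ∃ g : PSL2 F, V.character g ≠ 1) ∨
       (Even q ∧ Module.finrank ℂ V = q) ∨
       (q.Prime ∧ Odd q ∧ Module.finrank ℂ V = q - 1) ∨
       (q.Prime ∧ Odd q ∧ 3 < q ∧ q % 4 = 3 ∧ Module.finrank ℂ V = (q - 1) / 2)) := by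
  classical
  subst hF
  have hirr := FDRep.isIrreducible_of_simple V hV
  have hq : 1 < Fintype.card F := Fintype.one_lt_card
  rw [FDRep.not_isUnisingular_iff]
  by_cases hnt : ∃ g, V.ρ g ≠ 1
  · let π : SpecialLinearGroup (Fin 2) F →* PSL2 F := QuotientGroup.mk' _
    have hπ : Function.Surjective π := QuotientGroup.mk'_surjective _
    let ρ : Representation ℂ (SpecialLinearGroup (Fin 2) F) V := V.ρ.comp π
    have hρ : ρ.IsIrreducible := hirr.comp_of_surjective hπ
    have hneg : ρ (-1) = 1 := by
      have : π (-1) = 1 := (QuotientGroup.eq_one_iff _).2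
        (Subgroup.mem_center_iff.2 fun g => by rw [mul_neg, neg_mul, mul_one, one_mul])
      change V.ρ (π (-1)) = 1
      rw [this, map_one]
    have hnt' : ∃ g, ρ g ≠ 1 := hπ.exists.1 hnt
    have hfix : (∃ g, ∀ v, V.ρ g v = v → v = 0) ↔ ∃ x, ∀ v, ρ x v = v → v = 0 := hπ.exists
    obtain ⟨ψ, hψ1⟩ : ∃ ψ : AddChar F ℂ, ψ ≠ 1 := by
      obtain ⟨ψ, h⟩ := AddChar.exists_apply_ne_zero.2 (one_ne_zero (α := F))
      exact ⟨ψ, fun h' => h (by rw [h', AddChar.one_apply])⟩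
    have hψ : ψ.IsPrimitive := AddChar.IsPrimitive.of_ne_one hψ1
    have h1 : (finrank ℂ V = 1 ∧ ∃ g, V.character g ≠ 1) ↔ finrank ℂ V = 1 :=
      and_iff_left_of_imp fun h => (V.exists_character_ne_one_iff h).2 hnt
    rw [hfix, h1]
    by_cases h2 : (2 : F) = 0
    · have heven : Fintype.card F % 2 = 0 :=
        FiniteField.even_card_iff_char_two.1 (neg_one_eq_one_iff.1 (by linear_combination -h2))
      rw [SL2.exists_forall_fixed_eq_zero_iff_of_two_eq_zero hρ hψ hψ1 hneg hnt' h2,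
        Nat.even_iff, Nat.odd_iff]
      grind
    · have hodd : Fintype.card F % 2 = 1 := by
        by_contra h
        have : (-1 : F) = 1 := neg_one_eq_one_iff.2
          (FiniteField.even_card_iff_char_two.2 (by omega))
        exact h2 (by linear_combination -this)
      rw [SL2.exists_forall_fixed_eq_zero_iff_of_two_ne_zero hρ hψ hψ1 hneg hnt' h2,
        Nat.even_iff, Nat.odd_iff]
      grind
  · push Not at hnt
    have := hirr.nontrivial
    obtain ⟨v, hv⟩ := exists_ne (0 : V)
    have hdim : finrank ℂ V = 1 := finrank_eq_one v hv fun w => by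
      have h := hirr.eq_top_of_forall_mem hv (W := Submodule.span ℂ {v}) fun g => by
        rw [hnt]; exact Submodule.mem_span_singleton_self v
      exact Submodule.mem_span_singleton.1 (h ▸ Submodule.mem_top)
    have hl : ¬ ∃ g, ∀ v, V.ρ g v = v → v = 0 := fun ⟨g, hg⟩ => hv (hg v (by rw [hnt]; rfl))
    have hr : ¬ ∃ g, V.character g ≠ 1 := fun h => by
      obtain ⟨g, hg⟩ := (V.exists_character_ne_one_iff hdim).1 h
      exact hg (hnt g)
    rw [hdim]
    simp only [hl, hr, Nat.odd_iff]
    grind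
end
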